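/- arXiv:2312.00928 — 2 statements merged into one kernel-verified Lean document; each statement's English description precedes it below -/
import Mathlib

section
/- Let C be a cycle graph on n ≥ 3 vertices and let h be a hatness function with h(v) ≥ 2 for every vertex v of C. Then the hat guessing game ⟨C,h⟩ is winning if and only if at least one of the following conditions holds: (1) n = 4 or n is divisible by 3, and h(v) ≤ 3 for all v in C; (2) n = 3 and the sum over v in C of 1/h(v) is at least 1; (3) ⟨C,h⟩ contains a winning proper subgame; (4) both of the following hold: (a) there exist three consecutive vertices of C whose hatnesses, in order, are (2,3,3) or (3,2,3), and (b) h(v) ≤ 4 for all v in C. -/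
/-- The hat guessing game `⟨G, h⟩` is *winning*: there exists a strategy (one
deterministic guessing function per vertex, depending only on the colors of the
neighboring vertices) such that for every assignment of hat colors at least one
vertex guesses its own color correctly. -/
def HatGame.Winning {V : Type*} (G : SimpleGraph V) (h : V → ℕ) : Prop :=
  ∃ s : ∀ v : V, (∀ u : V, Fin (h u)) → Fin (h v),
    (∀ (v : V) (c c' : ∀ u : V, Fin (h u)),
        (∀ u : V, G.Adj v u → c u = c' u) → s v c = s v c') ∧
    ∀ c : ∀ u : V, Fin (h u), ∃ v : V, s v c = c v

/-- The hat guessing number of `G`: the largest `q` such that the game on `G`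
where every vertex has hatness `q` is winning. -/
noncomputable def HatGame.number {V : Type*} (G : SimpleGraph V) : ℕ :=
  sSup {q : ℕ | HatGame.Winning G (fun _ => q)}

/-- A cactus graph: a connected graph in which every pair of (distinct) cycles
shares at most one vertex. -/
def SimpleGraph.IsCactus {V : Type*} (G : SimpleGraph V) : Prop :=
  G.Connected ∧
    ∀ (v w : V) (c₁ : G.Walk v v) (c₂ : G.Walk w w), c₁.IsCycle → c₂.IsCycle →
      {e | e ∈ c₁.edges} ≠ {e | e ∈ c₂.edges} →
      ({x | x ∈ c₁.support} ∩ {x | x ∈ c₂.support} : Set V).Subsingleton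

namespace HatGame

/-- A tour of the cycle: a sequence running around it, in one of the two directions. -/
structure IsTour (n : ℕ) (π : ℕ → Fin n) : Prop where
  periodic : ∀ i, π (i + n) = π i
  surj : Function.Surjective π
  mod_eq : ∀ i j, π i = π j → i % n = j % n
  adj : ∀ i v, (SimpleGraph.cycleGraph n).Adj (π (i + 1)) v ↔ v = π i ∨ v = π (i + 2)

theorem cycleGraph_adj_iff {n : ℕ} [NeZero n] (hn : 3 ≤ n) (u v : Fin n) :
    (SimpleGraph.cycleGraph n).Adj u v ↔ v = u - 1 ∨ v = u + 1 := by
  obtain ⟨m, rfl⟩ : ∃ m, n = m + 2 := ⟨n - 2, by omega⟩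
  rw [SimpleGraph.cycleGraph_adj]
  constructor
  · rintro (h | h)
    · left; rw [← h]; abel
    · right; rw [← h]; abel
  · rintro (rfl | rfl)
    · left; abel
    · right; abel

theorem natCast_eq_mod {n : ℕ} [NeZero n] {i j : ℕ}
    (h : (Fin.ofNat n i) = (Fin.ofNat n j)) : i % n = j % n := by
  simpa [Fin.ext_iff] using h

theorem ofNat_succ {n : ℕ} [NeZero n] (hn : 3 ≤ n) (i : ℕ) :
    Fin.ofNat n (i + 1) = Fin.ofNat n i + 1 := by
  have : 1 % n = 1 := Nat.mod_eq_of_lt (by omega)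
  ext
  simp [Fin.val_add]

theorem isTour_add {n : ℕ} [NeZero n] (hn : 3 ≤ n) (s : Fin n) :
    IsTour n (fun i => s + Fin.ofNat n i) where
  periodic i := by congr 1; ext; simp
  surj v := ⟨(v - s).val, by simp⟩
  mod_eq i j h := natCast_eq_mod (add_left_cancel h)
  adj i v := by
    rw [cycleGraph_adj_iff hn, ofNat_succ hn (i + 1), ofNat_succ hn]
    have h1 : s + (Fin.ofNat n i + 1) - 1 = s + Fin.ofNat n i := by abel
    have h2 : s + (Fin.ofNat n i + 1) + 1 = s + (Fin.ofNat n i + 1 + 1) := by abel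
    rw [h1, h2]

theorem isTour_sub {n : ℕ} [NeZero n] (hn : 3 ≤ n) (s : Fin n) :
    IsTour n (fun i => s - Fin.ofNat n i) where
  periodic i := by congr 1; ext; simp
  surj v := ⟨(s - v).val, by simp⟩
  mod_eq i j h := natCast_eq_mod (sub_right_injective h)
  adj i v := by
    rw [cycleGraph_adj_iff hn, ofNat_succ hn (i + 1), ofNat_succ hn]
    have h1 : s - (Fin.ofNat n i + 1) - 1 = s - (Fin.ofNat n i + 1 + 1) := by abel
    have h2 : s - (Fin.ofNat n i + 1) + 1 = s - Fin.ofNat n i := by abel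
    rw [h1, h2, or_comm]

/-- The cyclic game along a sequence of hatnesses `H` of period `n`: the guessing functions `F`
win against every `n`-periodic coloring. -/
def SeqWin (n : ℕ) (H : ℕ → ℕ) (F : ℕ → ℕ → ℕ → ℕ) : Prop :=
  ∀ c : ℕ → ℕ, (∀ i, c (i + n) = c i) → (∀ i, c i < H i) →
    ∃ i, F (i + 1) (c i) (c (i + 2)) = c (i + 1)

theorem eq_of_mod_eq {α : Type*} {n : ℕ} {f : ℕ → α} (hf : ∀ i, f (i + n) = f i) {i j : ℕ}
    (h : i % n = j % n) : f i = f j := by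
  have key : ∀ i, f (i % n) = f i := fun i => Function.Periodic.map_mod_nat hf i
  rw [← key i, ← key j, h]

/-- A game is winning as soon as each vertex has an event determining its own color from those
of its neighbors, such that one of the events always happens. -/
theorem winning_of_events {V : Type*} {G : SimpleGraph V} {h : V → ℕ} (hpos : ∀ v, 0 < h v)
    (P : ∀ _ : V, (∀ u : V, Fin (h u)) → Prop)
    (hdet : ∀ v c c', (∀ u, G.Adj v u → c u = c' u) → P v c → P v c' → c v = c' v)
    (hcov : ∀ c, ∃ v, P v c) : Winning G h := by
  classical
  let pick (v : V) (Q : (∀ u : V, Fin (h u)) → Prop) : Fin (h v) :=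
    if hQ : ∃ c', Q c' then hQ.choose v else ⟨0, hpos v⟩
  refine ⟨fun v c => pick v fun c' => (∀ u, G.Adj v u → c u = c' u) ∧ P v c', ?_, ?_⟩
  · intro v c c' hcc
    refine congrArg (pick v) (funext fun c'' => propext (and_congr_left' ?_))
    exact forall_congr' fun u => imp_congr_right fun hu => by rw [hcc u hu]
  · intro c
    obtain ⟨v, hv⟩ := hcov c
    refine ⟨v, ?_⟩
    have hc : ∃ c', (∀ u, G.Adj v u → c u = c' u) ∧ P v c' := ⟨c, fun _ _ => rfl, hv⟩
    simp only [pick, dif_pos hc]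
    exact (hdet v _ _ hc.choose_spec.1 hv hc.choose_spec.2).symm

theorem winning_of_seqWin {n : ℕ} {h : Fin n → ℕ} (hpos : ∀ v, 0 < h v)
    {π : ℕ → Fin n} (hπ : IsTour n π) {F : ℕ → ℕ → ℕ → ℕ} (hF : ∀ i, F (i + n) = F i)
    (hw : SeqWin n (fun i => h (π i)) F) : Winning (SimpleGraph.cycleGraph n) h := by
  refine winning_of_events hpos
    (fun v c => ∃ i, π (i + 1) = v ∧ F (i + 1) (c (π i)) (c (π (i + 2))) = (c v).val) ?_ ?_
  · rintro v c c' hcc ⟨i, rfl, hi⟩ ⟨j, hj, hj'⟩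
    have hm : (i + 1) % n = (j + 1) % n := hπ.mod_eq _ _ hj.symm
    have e1 : i % n = j % n := Nat.ModEq.add_right_cancel' 1 hm
    have e2 : (i + 2) % n = (j + 2) % n := Nat.ModEq.add_right 2 e1
    rw [← eq_of_mod_eq hF hm, ← eq_of_mod_eq hπ.periodic e1, ← eq_of_mod_eq hπ.periodic e2,
      ← hcc _ ((hπ.adj i _).2 (Or.inl rfl)), ← hcc _ ((hπ.adj i _).2 (Or.inr rfl)), hi] at hj'
    exact Fin.ext hj'
  · intro c
    obtain ⟨i, hi⟩ := hw (fun i => (c (π i)).val) (fun i => by rw [hπ.periodic])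
      (fun i => (c (π i)).isLt)
    exact ⟨π (i + 1), i, rfl, hi⟩

theorem seqWin_of_winning {n : ℕ} (hn : 3 ≤ n) {h : Fin n → ℕ} (hpos : ∀ v, 0 < h v)
    {π : ℕ → Fin n} (hπ : IsTour n π) (hw : Winning (SimpleGraph.cycleGraph n) h) :
    ∃ F : ℕ → ℕ → ℕ → ℕ, (∀ i, F (i + n) = F i) ∧ SeqWin n (fun i => h (π i)) F := by
  classical
  obtain ⟨s, hloc, hs⟩ := hw
  have hmod : ∀ v x, x % h v < h v := fun v x => Nat.mod_lt x (hpos v)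
  refine ⟨fun i a b => (s (π i) (fun u => if u = π (i + (n - 1)) then ⟨a % h u, hmod u a⟩
    else ⟨b % h u, hmod u b⟩)).val, fun i => ?_, fun c hc hlt => ?_⟩
  · have : i + n + (n - 1) = i + (n - 1) + n := by omega
    funext a b
    simp only [this, hπ.periodic (i + (n - 1))]
    exact congrArg (fun v => (s v _).val) (hπ.periodic i)
  · have hlt' : ∀ i, c i < h (π i) := hlt
    choose idx hidx using hπ.surj
    obtain ⟨v, hv⟩ := hs (fun u => ⟨c (idx u), by have := hlt' (idx u); rwa [hidx] at this⟩)
    have hcu : ∀ i, c (idx (π i)) = c i := fun i =>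
      eq_of_mod_eq hc (hπ.mod_eq _ _ (hidx (π i)))
    obtain ⟨i, rfl⟩ : ∃ i, π (i + 1) = v := by
      refine ⟨idx v + (n - 1), ?_⟩
      have : idx v + (n - 1) + 1 = idx v + n := by omega
      rw [this, hπ.periodic, hidx]
    refine ⟨i, ?_⟩
    have hval := congrArg Fin.val hv
    simp only [hcu] at hval
    rw [← hval]
    refine congrArg Fin.val (hloc _ _ _ fun u hu => ?_)
    have hi : i + 1 + (n - 1) = i + n := by omega
    simp only [hi, hπ.periodic]
    rcases (hπ.adj i u).1 hu with rfl | rfl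
    · simp [hcu, Nat.mod_eq_of_lt (hlt' i)]
    · have hne : π (i + 2) ≠ π i := fun he => by
        have h0 := hπ.mod_eq _ _ he
        have h1 : (2 : ℕ) % n = 0 % n :=
          Nat.ModEq.add_left_cancel' i (show (i + 2) % n = (i + 0) % n from h0)
        rw [Nat.mod_eq_of_lt (by omega), Nat.zero_mod] at h1
        omega
      simp [hne, hcu, Nat.mod_eq_of_lt (hlt' (i + 2))]

theorem Winning.of_subgraph {V : Type*} {G : SimpleGraph V} {h : V → ℕ} (hpos : ∀ v, 0 < h v)
    (G' : G.Subgraph) (hw : Winning G'.coe (fun v => h v.val)) : Winning G h := by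
  obtain ⟨s, hloc, hs⟩ := hw
  refine winning_of_events hpos
    (fun v c => ∃ hv : v ∈ G'.verts, s ⟨v, hv⟩ (fun u => c u.val) = c v) ?_ ?_
  · rintro v c c' hcc ⟨hv, h1⟩ ⟨_, h2⟩
    rw [← h1, ← h2]
    exact hloc _ _ _ fun u hu => hcc u (G'.adj_sub hu)
  · intro c
    obtain ⟨v, hv⟩ := hs (fun u => c u.val)
    exact ⟨v.val, v.2, hv⟩

theorem mod_interval_unique {N m q lo t x y : ℕ} (hN : N = m * q) (hx : x < q) (hy : y < q)
    (h1 : lo ≤ (t + m * x) % N) (h2 : (t + m * x) % N < lo + m)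
    (h3 : lo ≤ (t + m * y) % N) (h4 : (t + m * y) % N < lo + m) : x = y := by
  have hm : 0 < m := by omega
  set r := (t + m * x) % N with hr
  set r' := (t + m * y) % N with hr'
  have e1 : r % m = t % m := by
    rw [hr, hN, Nat.mod_mul_right_mod, Nat.add_mul_mod_self_left]
  have e2 : r' % m = t % m := by
    rw [hr', hN, Nat.mod_mul_right_mod, Nat.add_mul_mod_self_left]
  have e3 : r = r' := by
    have h5 : r ≡ r' [MOD m] := e1.trans e2.symm
    rcases le_total r r' with h | h
    · have := (Nat.modEq_iff_dvd' h).1 h5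
      have := Nat.eq_zero_of_dvd_of_lt this (by omega)
      omega
    · have := (Nat.modEq_iff_dvd' h).1 h5.symm
      have := Nat.eq_zero_of_dvd_of_lt this (by omega)
      omega
  have e4 : m * x ≡ m * y [MOD m * q] := by
    rw [← hN]
    exact Nat.ModEq.add_left_cancel' t e3
  have e5 := Nat.ModEq.mul_left_cancel' hm.ne' e4
  exact Nat.ModEq.eq_of_lt_of_lt e5 hx hy

theorem winning_triangle {h : Fin 3 → ℕ} (hpos : ∀ v, 0 < h v)
    (hsum : 1 ≤ ∑ v, ((h v : ℚ))⁻¹) : Winning (SimpleGraph.cycleGraph 3) h := by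
  have h0 := hpos 0
  have h1 := hpos 1
  have h2 := hpos 2
  have hs : h 0 * h 1 * h 2 ≤ h 1 * h 2 + h 0 * h 2 + h 0 * h 1 := by
    have e0 : (0 : ℚ) < h 0 := by exact_mod_cast h0
    have e1 : (0 : ℚ) < h 1 := by exact_mod_cast h1
    have e2 : (0 : ℚ) < h 2 := by exact_mod_cast h2
    rw [Fin.sum_univ_three] at hsum
    have : (h 0 * h 1 * h 2 : ℚ) ≤ h 1 * h 2 + h 0 * h 2 + h 0 * h 1 := by
      have := mul_le_mul_of_nonneg_left hsum (by positivity : (0 : ℚ) ≤ h 0 * h 1 * h 2)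
      field_simp at this
      linarith
    exact_mod_cast this
  let S (c : ∀ u, Fin (h u)) : ℕ :=
    (h 1 * h 2 * c 0 + h 0 * h 2 * c 1 + h 0 * h 1 * c 2) % (h 0 * h 1 * h 2)
  have hadj : ∀ u v : Fin 3, u ≠ v → (SimpleGraph.cycleGraph 3).Adj u v := by decide
  refine winning_of_events hpos (fun v c => (v = 0 ∧ S c < h 1 * h 2) ∨
    (v = 1 ∧ h 1 * h 2 ≤ S c ∧ S c < h 1 * h 2 + h 0 * h 2) ∨
    (v = 2 ∧ h 1 * h 2 + h 0 * h 2 ≤ S c ∧ S c < h 1 * h 2 + h 0 * h 2 + h 0 * h 1)) ?_ ?_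
  · intro v c c' hcc hc hc'
    have hne : ∀ u, v ≠ u → c u = c' u := fun u hu => hcc u (hadj v u hu)
    rcases hc with ⟨rfl, hc⟩ | ⟨rfl, hc⟩ | ⟨rfl, hc⟩
    · replace hc' : S c' < h 1 * h 2 := by simpa using hc'
      simp only [S, ← hne 1 (by decide), ← hne 2 (by decide)] at hc hc'
      refine Fin.ext (mod_interval_unique (N := h 0 * h 1 * h 2) (m := h 1 * h 2) (lo := 0)
        (t := h 0 * h 2 * c 1 + h 0 * h 1 * c 2) (by ring) (c 0).isLt (c' 0).isLt
        (Nat.zero_le _) ?_ (Nat.zero_le _) ?_)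
      · rw [zero_add]; convert hc using 2; ring
      · rw [zero_add]; convert hc' using 2; ring
    · replace hc' : h 1 * h 2 ≤ S c' ∧ S c' < h 1 * h 2 + h 0 * h 2 := by simpa using hc'
      simp only [S, ← hne 0 (by decide), ← hne 2 (by decide)] at hc hc'
      have e : ∀ x, h 1 * h 2 * c 0 + h 0 * h 2 * x + h 0 * h 1 * c 2 =
        h 1 * h 2 * c 0 + h 0 * h 1 * c 2 + h 0 * h 2 * x := fun x => by ring
      rw [e] at hc hc'
      exact Fin.ext (mod_interval_unique (m := h 0 * h 2) (by ring) (c 1).isLt (c' 1).isLt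
        hc.1 hc.2 hc'.1 hc'.2)
    · replace hc' : h 1 * h 2 + h 0 * h 2 ≤ S c' ∧
        S c' < h 1 * h 2 + h 0 * h 2 + h 0 * h 1 := by simpa using hc'
      simp only [S, ← hne 0 (by decide), ← hne 1 (by decide)] at hc hc'
      exact Fin.ext (mod_interval_unique (m := h 0 * h 1) (by ring) (c 2).isLt (c' 2).isLt
        hc.1 hc.2 hc'.1 hc'.2)
  · intro c
    have hlt : S c < h 0 * h 1 * h 2 := Nat.mod_lt _ (by positivity)
    rcases lt_or_ge (S c) (h 1 * h 2) with h3 | h3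
    · exact ⟨0, Or.inl ⟨rfl, h3⟩⟩
    rcases lt_or_ge (S c) (h 1 * h 2 + h 0 * h 2) with h4 | h4
    · exact ⟨1, Or.inr (Or.inl ⟨rfl, h3, h4⟩)⟩
    · exact ⟨2, Or.inr (Or.inr ⟨rfl, h4, hlt.trans_le hs⟩)⟩

theorem one_le_sum_inv_of_winning {V : Type*} [Fintype V] {G : SimpleGraph V} {h : V → ℕ}
    (hpos : ∀ v, 0 < h v) (hw : Winning G h) : 1 ≤ ∑ v, ((h v : ℚ))⁻¹ := by
  classical
  obtain ⟨s, hloc, hs⟩ := hw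
  let A (v : V) : Finset (∀ u, Fin (h u)) := {c | s v c = c v}
  have hA : ∀ v, (A v).card * h v ≤ Fintype.card (∀ u, Fin (h u)) := by
    intro v
    have := Finset.card_le_card_of_injOn (s := A v ×ˢ (Finset.univ : Finset (Fin (h v))))
      (t := (Finset.univ : Finset (∀ u, Fin (h u))))
      (fun p => Function.update p.1 v p.2) (fun _ _ => Finset.mem_coe.2 (Finset.mem_univ _)) ?_
    · simpa [Finset.card_product] using this
    · rintro ⟨c, i⟩ hc ⟨c', i'⟩ hc' he
      simp only [A, Finset.coe_product, Set.mem_prod, Finset.mem_coe, Finset.mem_filter,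
        Finset.mem_univ, true_and, and_true] at hc hc'
      have hi : i = i' := by simpa using congrFun he v
      have hne : ∀ u, u ≠ v → c u = c' u := fun u hu => by simpa [hu] using congrFun he u
      have hv : c v = c' v := by
        rw [← hc, ← hc']
        exact hloc v c c' fun u hu => hne u hu.ne'
      refine Prod.ext (funext fun u => ?_) hi
      by_cases hu : u = v
      · subst hu; exact hv
      · exact hne u hu
  have hcov : Fintype.card (∀ u, Fin (h u)) ≤ ∑ v, (A v).card := by
    rw [← Finset.card_univ]
    refine le_trans (Finset.card_le_card ?_) Finset.card_biUnion_le
    intro c _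
    obtain ⟨v, hv⟩ := hs c
    simp only [Finset.mem_biUnion, Finset.mem_univ, true_and]
    exact ⟨v, by simpa [A] using hv⟩
  have hN : 0 < Fintype.card (∀ u, Fin (h u)) :=
    Fintype.card_pos_iff.2 ⟨fun u => ⟨0, hpos u⟩⟩
  set N := Fintype.card (∀ u, Fin (h u))
  have hN' : (0 : ℚ) < N := by exact_mod_cast hN
  have : (N : ℚ) * 1 ≤ N * ∑ v, ((h v : ℚ))⁻¹ := by
    calc (N : ℚ) * 1 ≤ ∑ v, ((A v).card : ℚ) := by rw [mul_one]; exact_mod_cast hcov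
      _ ≤ ∑ v, (N : ℚ) * ((h v : ℚ))⁻¹ := by
        refine Finset.sum_le_sum fun v _ => ?_
        have hv : (0 : ℚ) < h v := by exact_mod_cast hpos v
        rw [← div_eq_mul_inv, le_div_iff₀ hv]
        exact_mod_cast hA v
      _ = _ := by rw [Finset.mul_sum]
  exact le_of_mul_le_mul_left this hN'

/-- Guess the left neighbor's color unless both neighbors agree, in which case guess
the preceding color. -/
def leftGuess (a b : ZMod 3) : ZMod 3 := if b = a then a - 1 else a

theorem exists_seqWin_of_three_dvd {n : ℕ} (hn : 0 < n) (h3 : 3 ∣ n) {H : ℕ → ℕ}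
    (hH : ∀ i, H i ≤ 3) : ∃ F : ℕ → ℕ → ℕ → ℕ, (∀ i, F (i + n) = F i) ∧ SeqWin n H F := by
  refine ⟨fun j a b => (leftGuess ((a : ZMod 3) - if n ∣ j then 1 else 0)
    ((b : ZMod 3) + if n ∣ j + 1 then 1 else 0)).val, fun i => ?_, fun c hc hlt => ?_⟩
  · funext a b
    have h1 : n ∣ i + n ↔ n ∣ i := by simp
    have h2 : n ∣ i + n + 1 ↔ n ∣ i + 1 := by
      rw [show i + n + 1 = i + 1 + n by ring]; simp
    simp only [h1, h2]
  · by_contra! hne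
    let e : ℕ → ZMod 3 := fun i => (c i : ZMod 3) + (i / n : ℕ)
    let d : ℕ → ZMod 3 := fun i => e (i + 1) - e i
    have hen : ∀ i, e (i + n) = e i + 1 := fun i => by
      simp only [e, hc, Nat.add_div_right _ hn]; push_cast; ring
    have hdn : ∀ i, d (i + n) = d i := fun i => by
      simp only [d]
      rw [show i + n + 1 = i + 1 + n by ring, hen, hen]; ring
    have hwrong : ∀ i, leftGuess (e i) (e (i + 2)) ≠ e (i + 1) := by
      intro i hi
      apply hne i
      have h1 : ((c i : ZMod 3) - if n ∣ i + 1 then 1 else 0) = e i - ((i + 1) / n : ℕ) := by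
        simp only [e, Nat.succ_div]; split_ifs <;> push_cast <;> ring
      have h2 : ((c (i + 2) : ZMod 3) + if n ∣ i + 1 + 1 then 1 else 0) =
          e (i + 2) - ((i + 1) / n : ℕ) := by
        have : (i + 2) / n = (i + 1) / n + if n ∣ i + 1 + 1 then 1 else 0 := Nat.succ_div
        simp only [e, this]; split_ifs <;> push_cast <;> ring
      have h3 : ∀ x y t : ZMod 3, leftGuess (x - t) (y - t) = leftGuess x y - t := by decide
      rw [h1, h2, h3, hi]
      simp only [e, add_sub_cancel_right]
      exact ZMod.val_cast_of_lt ((hlt _).trans_le (hH _))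
    let r : ZMod 3 → ℕ := fun x => if x = 1 then 0 else if x = -1 then 1 else 2
    have hr : Function.Injective r := by decide
    have hmono : Monotone fun i => r (d i) := by
      have : ∀ x y z : ZMod 3, leftGuess x z ≠ y → r (y - x) ≤ r (z - y) := by decide
      exact monotone_nat_of_le_succ fun i => this _ _ _ (hwrong i)
    have hconst : ∀ i, d i = d 0 := by
      intro i
      have h1 : d (0 + i * n) = d 0 := Function.Periodic.nat_mul (f := d) (c := n) hdn i 0
      have h2 : r (d i) ≤ r (d (0 + i * n)) :=
        hmono (by rw [zero_add]; exact Nat.le_mul_of_pos_right _ hn)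
      rw [h1] at h2
      exact hr (le_antisymm h2 (hmono (Nat.zero_le i)))
    have hlin : ∀ i : ℕ, e i = e 0 + i * d 0 := by
      intro i
      induction i with
      | zero => simp
      | succ i ih =>
        have : e (i + 1) = e i + d i := by simp [d]
        rw [this, ih, hconst i]; push_cast; ring
    have h1 := hlin n
    have h2 := hen 0
    have h4 : (n : ZMod 3) = 0 := (ZMod.natCast_eq_zero_iff n 3).2 h3
    rw [zero_add, h1, h4] at h2
    revert h2
    generalize e 0 = x
    generalize d 0 = y
    revert x y
    decide

theorem exists_seqWin_four {H : ℕ → ℕ} (hH : ∀ i, H i ≤ 3) :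
    ∃ F : ℕ → ℕ → ℕ → ℕ, (∀ i, F (i + 4) = F i) ∧ SeqWin 4 H F := by
  let f : Fin 4 → Fin 3 → Fin 3 → Fin 3 :=
    ![![![2, 2, 0], ![0, 2, 1], ![1, 0, 1]], ![![0, 2, 1], ![1, 0, 1], ![2, 2, 0]],
      ![![2, 0, 1], ![0, 1, 1], ![2, 2, 0]], ![![1, 0, 2], ![0, 0, 1], ![2, 1, 2]]]
  have key : ∀ x y z t : Fin 3, f 1 x z = y ∨ f 2 y t = z ∨ f 3 z x = t ∨ f 0 t y = x := by
    decide
  refine ⟨fun i a b => f (Fin.ofNat 4 i) (Fin.ofNat 3 a) (Fin.ofNat 3 b), fun i => ?_,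
    fun c hc hlt => ?_⟩
  · have : Fin.ofNat 4 (i + 4) = Fin.ofNat 4 i := by ext; simp
    simp only [this]
  · have hv : ∀ i, (Fin.ofNat 3 (c i)).val = c i := fun i => by
      simpa using Nat.mod_eq_of_lt ((hlt i).trans_le (hH i))
    have h4 : c 4 = c 0 := hc 0
    have h5 : c 5 = c 1 := hc 1
    rcases key (Fin.ofNat 3 (c 0)) (Fin.ofNat 3 (c 1)) (Fin.ofNat 3 (c 2)) (Fin.ofNat 3 (c 3))
      with h | h | h | h
    · exact ⟨0, (congrArg Fin.val h).trans (hv 1)⟩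
    · exact ⟨1, (congrArg Fin.val h).trans (hv 2)⟩
    · refine ⟨2, ?_⟩
      rw [show 2 + 2 = 4 from rfl, h4]
      exact (congrArg Fin.val h).trans (hv 3)
    · refine ⟨3, ?_⟩
      rw [show 3 + 2 = 5 from rfl, show 3 + 1 = 4 from rfl, h5, h4]
      exact (congrArg Fin.val h).trans (hv 0)

/-- The bit game along a path: if the left end and all inner vertices are wrong, then the
right end is right. -/
theorem bit_chain {a b : ℕ} (hab : a < b) {L R : ℕ → ℕ} (hL : ∀ j, a < j → j ≤ b → L j < 2)
    (hR : ∀ j, a ≤ j → j < b → R j < 2) (h0 : R a ≠ L (a + 1))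
    (hstep : ∀ j, a < j → j < b → ¬(L j + R (j - 1) = 1 ∧ R j = L (j + 1))) :
    L b + R (b - 1) = 1 := by
  have key : ∀ k, a + 1 + k ≤ b → L (a + 1 + k) + R (a + k) = 1 := by
    intro k
    induction k with
    | zero =>
      intro hk
      have := hL (a + 1) (by omega) hk
      have := hR a le_rfl (by omega)
      simp only [add_zero]
      omega
    | succ k ih =>
      intro hk
      have h1 := ih (by omega)
      have h2 := hstep (a + 1 + k) (by omega) (by omega)
      rw [show a + 1 + k - 1 = a + k by omega] at h2
      have := hL (a + 1 + k + 1) (by omega) (by omega)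
      have := hR (a + 1 + k) (by omega) (by omega)
      rw [show a + 1 + (k + 1) = a + 1 + k + 1 by omega, show a + (k + 1) = a + 1 + k by omega]
      have h3 : R (a + 1 + k) ≠ L (a + 1 + k + 1) := fun h => h2 ⟨h1, h⟩
      omega
  have := key (b - (a + 1)) (by omega)
  rwa [show a + 1 + (b - (a + 1)) = b by omega, show a + (b - (a + 1)) = b - 1 by omega] at this

/-- The rest of the cycle, with hatnesses at most `4`, gives a correct hint bit to one of the ends
of a path on three vertices. -/
theorem exists_seqWin_of_hints {n : ℕ} (hn : 4 ≤ n) {H : ℕ → ℕ} (h4 : ∀ i, H i ≤ 4)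
    {bx bz : ℕ → ℕ} {gx gz fy : ℕ → ℕ → ℕ} (hbx : ∀ x, bx x < 2) (hbz : ∀ z, bz z < 2)
    (hred : ∀ p < 2, ∀ q < 2, ∀ x < H 0, ∀ y < H 1, ∀ z < H 2, p = bz z ∨ q = bx x →
      gx q y = x ∨ fy x z = y ∨ gz p y = z) :
    ∃ F : ℕ → ℕ → ℕ → ℕ, (∀ i, F (i + n) = F i) ∧ SeqWin n H F := by
  refine ⟨fun j a b => if j % n = 0 then gx (1 - a % 2) b else if j % n = 1 then fy a b else
    if j % n = 2 then gz (b / 2) a else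
    2 * (1 - if j % n = 3 then bz a else a % 2) + if j % n = n - 1 then bx b else b / 2,
    fun i => by simp, fun c hc hlt => ?_⟩
  by_contra! hne
  have hcn : c n = c 0 := by simpa using hc 0
  have hcn1 : c (n + 1) = c 1 := by simpa [add_comm] using hc 1
  have hc4 : ∀ i, c i < 4 := fun i => (hlt i).trans_le (h4 i)
  have hx : gx (1 - c (n - 1) % 2) (c 1) ≠ c 0 := by
    have := hne (n - 1)
    rw [show n - 1 + 1 = n by omega, show n - 1 + 2 = n + 1 by omega, hcn, hcn1] at this
    simpa using this
  have hy : fy (c 0) (c 2) ≠ c 1 := by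
    have := hne 0
    rw [Nat.mod_eq_of_lt (show 0 + 1 < n by omega)] at this
    simpa using this
  have hz : gz (c 3 / 2) (c 1) ≠ c 2 := by
    have := hne 1
    rw [Nat.mod_eq_of_lt (show 1 + 1 < n by omega)] at this
    simpa using this
  have hno : ∀ p < 2, ∀ q < 2, p = c 3 / 2 → q = 1 - c (n - 1) % 2 →
      ¬(p = bz (c 2) ∨ q = bx (c 0)) := by
    rintro p hp q hq rfl rfl h
    rcases hred _ hp _ hq _ (hlt 0) _ (hlt 1) _ (hlt 2) h with h | h | h
    exacts [hx h, hy h, hz h]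
  have h3 := hc4 3
  have hno' := hno _ (by omega) _ (by omega) rfl rfl
  have key := bit_chain (a := 2) (b := n) (by omega)
    (L := fun j => if j = n then bx (c n) else c j / 2)
    (R := fun j => if j = 2 then bz (c 2) else c j % 2)
    (fun j _ _ => by
      have := hc4 j; have := hbx (c n)
      split_ifs <;> omega)
    (fun j _ _ => by
      have := hbz (c 2)
      split_ifs <;> omega)
    (by simp only [show ¬ (2 + 1 = n) by omega, if_true, if_false];
        exact fun h => hno' (Or.inl h.symm))
    (by
      rintro j hj hjn ⟨h1, h2⟩
      have := hne (j - 1)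
      rw [show j - 1 + 1 = j by omega, show j - 1 + 2 = j + 1 by omega,
        Nat.mod_eq_of_lt hjn, if_neg (by omega), if_neg (by omega), if_neg (by omega)] at this
      apply this
      have := hc4 j
      have e1 : (if j - 1 = 2 then bz (c 2) else c (j - 1) % 2) =
          if j = 3 then bz (c (j - 1)) else c (j - 1) % 2 := by
        by_cases h : j = 3
        · subst h; simp
        · rw [if_neg h, if_neg (by omega)]
      have e2 : (if j + 1 = n then bx (c n) else c (j + 1) / 2) =
          if j = n - 1 then bx (c (j + 1)) else c (j + 1) / 2 := by
        by_cases h : j = n - 1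
        · have h' : j + 1 = n := by omega
          rw [if_pos h, if_pos h', h']
        · rw [if_neg h, if_neg (by omega)]
      rw [if_neg (by omega), e1] at h1
      rw [if_neg (by omega), e2] at h2
      omega)
  simp only [if_true, show ¬ (n - 1 = 2) by omega, if_false, hcn] at key
  exact hno' (Or.inr (by omega))

theorem exists_seqWin_two_three_three {n : ℕ} (hn : 4 ≤ n) {H : ℕ → ℕ} (h4 : ∀ i, H i ≤ 4)
    (h0 : H 0 = 2) (h1 : H 1 = 3) (h2 : H 2 = 3) :
    ∃ F : ℕ → ℕ → ℕ → ℕ, (∀ i, F (i + n) = F i) ∧ SeqWin n H F := by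
  refine exists_seqWin_of_hints hn h4 (bx := fun x => if x = 0 then 0 else 1)
    (bz := fun z => if z = 2 then 1 else 0)
    (gx := fun q y => if q + y = 0 ∨ y = 1 ∧ q = 0 ∨ q = 1 ∧ y = 0 then 0 else 1)
    (gz := fun p y => if y = 1 then (if p = 0 then 1 else 2) else 0)
    (fy := fun x z => if z = 0 then 1 else if x = 0 then 2 else 0) ?_ ?_ ?_
  · intro x; split_ifs <;> omega
  · intro x; split_ifs <;> omega
  · rw [h0, h1, h2]
    intro p hp q hq x hx y hy z hz
    interval_cases p <;> interval_cases q <;> interval_cases x <;> interval_cases y <;>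
      interval_cases z <;> decide

theorem exists_seqWin_three_two_three {n : ℕ} (hn : 4 ≤ n) {H : ℕ → ℕ} (h4 : ∀ i, H i ≤ 4)
    (h0 : H 0 = 3) (h1 : H 1 = 2) (h2 : H 2 = 3) :
    ∃ F : ℕ → ℕ → ℕ → ℕ, (∀ i, F (i + n) = F i) ∧ SeqWin n H F := by
  refine exists_seqWin_of_hints hn h4 (bx := fun x => if x = 2 then 1 else 0)
    (bz := fun z => if z = 2 then 1 else 0)
    (gx := fun q y => if y = 0 then 0 else q + 1)
    (gz := fun p y => if y = 0 then 0 else p + 1)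
    (fy := fun x z => if x = 0 ∨ z = 0 then 1 else 0) ?_ ?_ ?_
  · intro x; split_ifs <;> omega
  · intro x; split_ifs <;> omega
  · rw [h0, h1, h2]
    intro p hp q hq x hx y hy z hz
    interval_cases p <;> interval_cases q <;> interval_cases x <;> interval_cases y <;>
      interval_cases z <;> decide

/-- A path with both end hatnesses `2` and inner hatnesses at most `4` is a winning subgame. -/
theorem exists_winning_subgraph {n : ℕ} (hn : 3 ≤ n) {h : Fin n → ℕ} (hpos : ∀ v, 0 < h v)
    {π : ℕ → Fin n} (hπ : IsTour n π) {l : ℕ} (hl0 : 0 < l) (hln : l < n)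
    (h0 : h (π 0) = 2) (hl : h (π l) = 2) (hin : ∀ j, 0 < j → j < l → h (π j) ≤ 4) :
    ∃ G' : (SimpleGraph.cycleGraph n).Subgraph, G' ≠ ⊤ ∧ Winning G'.coe (fun v => h v.val) := by
  have hinj : ∀ i j, i < n → j < n → π i = π j → i = j := fun i j hi hj hij => by
    have := hπ.mod_eq i j hij
    rwa [Nat.mod_eq_of_lt hi, Nat.mod_eq_of_lt hj] at this
  let G' : (SimpleGraph.cycleGraph n).Subgraph :=
    { verts := Set.univ
      Adj := fun u v => ∃ j < l, (u = π j ∧ v = π (j + 1)) ∨ (v = π j ∧ u = π (j + 1))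
      adj_sub := by
        rintro u v ⟨j, -, ⟨rfl, rfl⟩ | ⟨rfl, rfl⟩⟩
        · exact ((hπ.adj j _).2 (Or.inl rfl)).symm
        · exact (hπ.adj j _).2 (Or.inl rfl)
      edge_vert := fun _ => Set.mem_univ _
      symm := ⟨fun u v ⟨j, hj, h⟩ => ⟨j, hj, h.symm⟩⟩ }
  have hadj : ∀ j (_ : j < l), G'.Adj (π j) (π (j + 1)) := fun j hj => ⟨j, hj, Or.inl ⟨rfl, rfl⟩⟩
  refine ⟨G', fun htop => ?_, ?_⟩
  · have h1 : (⊤ : (SimpleGraph.cycleGraph n).Subgraph).Adj (π l) (π (l + 1)) :=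
      ((hπ.adj l _).2 (Or.inl rfl)).symm
    rw [← htop] at h1
    obtain ⟨j, hj, ⟨h1, -⟩ | ⟨h1, h2⟩⟩ := h1
    · have := hinj _ _ hln (by omega) h1
      omega
    · have h3 := hinj _ _ hln (by omega) h2
      have h4 := hπ.mod_eq _ _ h1
      have h5 : (2 : ℕ) % n = 0 % n := Nat.ModEq.add_left_cancel' j
        (show (j + 2) % n = (j + 0) % n by rw [show j + 2 = l + 1 by omega]; exact h4)
      rw [Nat.mod_eq_of_lt (by omega), Nat.zero_mod] at h5
      omega
  · let L (c : ∀ u : G'.verts, Fin (h u.val)) (j : ℕ) : ℕ :=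
      if j = l then (c ⟨π j, trivial⟩).val else (c ⟨π j, trivial⟩).val / 2
    let R (c : ∀ u : G'.verts, Fin (h u.val)) (j : ℕ) : ℕ := (c ⟨π j, trivial⟩).val % 2
    refine winning_of_events (fun v => hpos _) (fun v c => ∃ j ≤ l, v.val = π j ∧
      (0 < j → L c j + R c (j - 1) = 1) ∧ (j < l → R c j = L c (j + 1))) ?_ ?_
    · rintro ⟨v, _⟩ c c' hcc ⟨j, hj, rfl, h1, h2⟩ ⟨j', hj', hjj, h1', h2'⟩
      obtain rfl : j = j' := hinj _ _ (by omega) (by omega) hjj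
      have hprev : 0 < j → R c (j - 1) = R c' (j - 1) := fun h => by
        have := hcc ⟨π (j - 1), trivial⟩ (by
          have := hadj (j - 1) (by omega)
          rw [show j - 1 + 1 = j by omega] at this
          exact this.symm)
        simp only [R, this]
      have hnext : j < l → L c (j + 1) = L c' (j + 1) := fun h => by
        have := hcc ⟨π (j + 1), trivial⟩ (hadj j h)
        simp only [L, this]
      have hb := (c ⟨π j, trivial⟩).isLt
      have hb' := (c' ⟨π j, trivial⟩).isLt
      apply Fin.ext
      rcases Nat.eq_zero_or_pos j with rfl | hj0
      · have e1 := h2 hl0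
        rw [hnext hl0, ← h2' hl0] at e1
        simp only [R, h0] at e1 hb hb'
        omega
      · have e1 := h1 hj0
        have e2 := h1' hj0
        rw [hprev hj0] at e1
        rcases hj.eq_or_lt with rfl | hlt
        · simp only [L, if_true] at e1 e2
          omega
        · have e3 := h2 hlt
          rw [hnext hlt, ← h2' hlt] at e3
          have := hin j hj0 hlt
          simp only [L, R, if_neg hlt.ne] at e1 e2 e3
          omega
    · intro c
      by_contra! hne
      have hwrong : ∀ j ≤ l, ¬((0 < j → L c j + R c (j - 1) = 1) ∧ (j < l → R c j = L c (j + 1))) :=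
        fun j hj ⟨h1, h2⟩ => by
          obtain ⟨h3, h4⟩ := hne ⟨π j, trivial⟩ j hj rfl h1
          exact h4 (h2 h3)
      refine hwrong l le_rfl ⟨fun _ => bit_chain hl0 (L := L c) (R := R c) ?_ ?_ ?_ ?_, by simp⟩
      · intro j hj hjl
        have hb : (c ⟨π j, trivial⟩).val < h (π j) := (c ⟨π j, trivial⟩).isLt
        rcases hjl.eq_or_lt with rfl | hlt
        · simp only [L, if_true]; omega
        · have := hin j hj hlt
          simp only [L, if_neg hlt.ne]; omega
      · intro j _ _; simp only [R]; omega
      · intro h; exact hwrong 0 hl0.le ⟨by simp, fun _ => h⟩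
      · intro j hj hjl h
        exact hwrong j hjl.le ⟨fun _ => h.1, fun _ => h.2⟩

/-- `Reach F H x b k` is the set of pairs of colors at positions `k + 1`, `k + 2` which extend the
colors `x`, `b` at positions `1`, `2` so that all guesses strictly in between are wrong. -/
def Reach (F : ℕ → ℕ → ℕ → ℕ) (H : ℕ → ℕ) (x b : ℕ) : ℕ → ℕ → ℕ → Prop
  | 0, u, v => u = x ∧ v = b
  | k + 1, v, w => w < H (k + 3) ∧ ∃ u, Reach F H x b k u v ∧ F (k + 2) u w ≠ v

/-- Two reachable colors with a common predecessor. -/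
def Fork (F : ℕ → ℕ → ℕ → ℕ) (H : ℕ → ℕ) (x b k : ℕ) : Prop :=
  ∃ u v v', v ≠ v' ∧ Reach F H x b k u v ∧ Reach F H x b k u v'

/-- Three reachable colors, any two of which have a common predecessor. -/
def Trident (F : ℕ → ℕ → ℕ → ℕ) (H : ℕ → ℕ) (x b k : ℕ) : Prop :=
  ∃ v₁ v₂ v₃, v₁ ≠ v₂ ∧ v₁ ≠ v₃ ∧ v₂ ≠ v₃ ∧
    (∃ u, Reach F H x b k u v₁ ∧ Reach F H x b k u v₂) ∧
    (∃ u, Reach F H x b k u v₁ ∧ Reach F H x b k u v₃) ∧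
    (∃ u, Reach F H x b k u v₂ ∧ Reach F H x b k u v₃)

section Front

variable {F : ℕ → ℕ → ℕ → ℕ} {H : ℕ → ℕ} {x b k : ℕ}

theorem Trident.fork (h : Trident F H x b k) : Fork F H x b k := by
  obtain ⟨v₁, v₂, v₃, h12, -, -, ⟨u, hu⟩, -⟩ := h
  exact ⟨u, v₁, v₂, h12, hu⟩

theorem reach_step {u v v' w : ℕ} (hv : Reach F H x b k u v) (hv' : Reach F H x b k u v')
    (hne : v ≠ v') (hw : w < H (k + 3)) :
    Reach F H x b (k + 1) v w ∨ Reach F H x b (k + 1) v' w := by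
  by_cases h : F (k + 2) u w = v
  · exact Or.inr ⟨hw, u, hv', fun h' => hne (h.symm.trans h')⟩
  · exact Or.inl ⟨hw, u, hv, h⟩

theorem Trident.step (h : Trident F H x b k) : ∃ P : Fin 3 → ℕ, ∀ w < H (k + 3),
    (Reach F H x b (k + 1) (P 0) w ∧ Reach F H x b (k + 1) (P 1) w) ∨
    (Reach F H x b (k + 1) (P 0) w ∧ Reach F H x b (k + 1) (P 2) w) ∨
    (Reach F H x b (k + 1) (P 1) w ∧ Reach F H x b (k + 1) (P 2) w) := by
  obtain ⟨v₁, v₂, v₃, h12, h13, h23, ⟨u, hu, hu'⟩, ⟨t, ht, ht'⟩, s, hs, hs'⟩ := h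
  refine ⟨![v₁, v₂, v₃], fun w hw => ?_⟩
  have e1 := reach_step hu hu' h12 hw
  have e2 := reach_step ht ht' h13 hw
  have e3 := reach_step hs hs' h23 hw
  simp only [Matrix.cons_val]
  tauto

theorem Fork.fork_succ (h : Fork F H x b k) (hH : 3 ≤ H (k + 3)) : Fork F H x b (k + 1) := by
  obtain ⟨u, v, v', hne, hv, hv'⟩ := h
  rcases reach_step hv hv' hne (show 0 < H (k + 3) by omega) with h0 | h0 <;>
  rcases reach_step hv hv' hne (show 1 < H (k + 3) by omega) with h1 | h1 <;>
  rcases reach_step hv hv' hne (show 2 < H (k + 3) by omega) with h2 | h2 <;>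
  first
  | exact ⟨_, 0, 1, by decide, h0, h1⟩
  | exact ⟨_, 0, 2, by decide, h0, h2⟩
  | exact ⟨_, 1, 2, by decide, h1, h2⟩

theorem Fork.trident_succ (h : Fork F H x b k) (hH : 5 ≤ H (k + 3)) : Trident F H x b (k + 1) := by
  classical
  obtain ⟨u, v, v', hne, hv, hv'⟩ := h
  have main : ∀ v, 2 < ((Finset.range 5).filter fun w => Reach F H x b (k + 1) v w).card →
      Trident F H x b (k + 1) := by
    intro v h2
    obtain ⟨p, hp, q, hq, r, hr, hpq, hpr, hqr⟩ := Finset.two_lt_card.1 h2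
    simp only [Finset.mem_filter] at hp hq hr
    exact ⟨p, q, r, hpq, hpr, hqr, ⟨v, hp.2, hq.2⟩, ⟨v, hp.2, hr.2⟩, v, hq.2, hr.2⟩
  by_contra hcon
  have h1 := not_lt.1 fun h => hcon (main v h)
  have h2 := not_lt.1 fun h => hcon (main v' h)
  have h3 : Finset.range 5 ⊆ ((Finset.range 5).filter fun w => Reach F H x b (k + 1) v w) ∪
      ((Finset.range 5).filter fun w => Reach F H x b (k + 1) v' w) := by
    intro w hw
    have := reach_step hv hv' hne (show w < H (k + 3) by have := Finset.mem_range.1 hw; omega)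
    simpa [Finset.mem_range.1 hw] using this
  have h4 := (Finset.card_le_card h3).trans (Finset.card_union_le _ _)
  rw [Finset.card_range] at h4
  omega

theorem Trident.common_pred (h : Trident F H x b k) {w w' : ℕ} (hw : w < H (k + 3))
    (hw' : w' < H (k + 3)) :
    ∃ v, Reach F H x b (k + 1) v w ∧ Reach F H x b (k + 1) v w' := by
  obtain ⟨P, hP⟩ := h.step
  rcases hP w hw with h1 | h1 | h1 <;> rcases hP w' hw' with h2 | h2 | h2 <;>
  first
  | exact ⟨_, h1.1, h2.1⟩
  | exact ⟨_, h1.1, h2.2⟩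
  | exact ⟨_, h1.2, h2.1⟩
  | exact ⟨_, h1.2, h2.2⟩

theorem Trident.trident_succ (h : Trident F H x b k) (hH : 3 ≤ H (k + 3)) :
    Trident F H x b (k + 1) :=
  ⟨0, 1, 2, by decide, by decide, by decide, h.common_pred (by omega) (by omega),
    h.common_pred (by omega) (by omega), h.common_pred (by omega) (by omega)⟩

theorem Trident.fork_succ (h : Trident F H x b k) (hH : 2 ≤ H (k + 3)) :
    Fork F H x b (k + 1) := by
  obtain ⟨v, h0, h1⟩ := h.common_pred (w := 0) (w' := 1) (by omega) (by omega)
  exact ⟨v, 0, 1, by decide, h0, h1⟩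

theorem reach_one {w : ℕ} (hw : w < H 3) (h : F 2 x w ≠ b) : Reach F H x b 1 b w :=
  ⟨hw, x, ⟨rfl, rfl⟩, h⟩

theorem fork_one {q : ℕ} (hq : q ≤ H 3)
    (h : 1 < ((Finset.range q).filter fun w => F 2 x w ≠ b).card) : Fork F H x b 1 := by
  obtain ⟨w, hw, w', hw', hne⟩ := Finset.one_lt_card.1 h
  simp only [Finset.mem_filter, Finset.mem_range] at hw hw'
  exact ⟨b, w, w', hne, reach_one (hw.1.trans_le hq) hw.2, reach_one (hw'.1.trans_le hq) hw'.2⟩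

theorem trident_one {q : ℕ} (hq : q ≤ H 3)
    (h : 2 < ((Finset.range q).filter fun w => F 2 x w ≠ b).card) : Trident F H x b 1 := by
  obtain ⟨p, hp, r, hr, s, hs, hpr, hps, hrs⟩ := Finset.two_lt_card.1 h
  simp only [Finset.mem_filter, Finset.mem_range] at hp hr hs
  have h1 := reach_one (hp.1.trans_le hq) hp.2
  have h2 := reach_one (hr.1.trans_le hq) hr.2
  have h3 := reach_one (hs.1.trans_le hq) hs.2
  exact ⟨p, r, s, hpr, hps, hrs, ⟨b, h1, h2⟩, ⟨b, h1, h3⟩, b, h2, h3⟩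

theorem Fork.fork_of_le (h : Fork F H x b k) {m : ℕ} (hkm : k ≤ m)
    (hH : ∀ i, k + 3 ≤ i → i ≤ m + 2 → 3 ≤ H i) : Fork F H x b m := by
  induction m, hkm using Nat.le_induction with
  | base => exact h
  | succ m hm ih =>
    exact (ih fun i h1 h2 => hH i h1 (by omega)).fork_succ (hH _ (by omega) (by omega))

theorem Trident.trident_of_le (h : Trident F H x b k) {m : ℕ} (hkm : k ≤ m)
    (hH : ∀ i, k + 3 ≤ i → i ≤ m + 2 → 3 ≤ H i) : Trident F H x b m := by
  induction m, hkm using Nat.le_induction with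
  | base => exact h
  | succ m hm ih =>
    exact (ih fun i h1 h2 => hH i h1 (by omega)).trident_succ (hH _ (by omega) (by omega))

theorem exists_coloring_of_reach {u v : ℕ} (h : Reach F H x b k u v) (hx : x < H 1)
    (hb : b < H 2) : ∃ c : ℕ → ℕ, c 1 = x ∧ c 2 = b ∧ c (k + 1) = u ∧ c (k + 2) = v ∧
      (∀ i, 1 ≤ i → i ≤ k + 2 → c i < H i) ∧
      ∀ i < k, F (i + 2) (c (i + 1)) (c (i + 3)) ≠ c (i + 2) := by
  induction k generalizing u v with
  | zero =>
    obtain ⟨rfl, rfl⟩ := h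
    refine ⟨fun i => if i = 1 then u else v, by simp, by simp, by simp, by simp, ?_, by simp⟩
    intro i h1 h2
    obtain rfl | rfl : i = 1 ∨ i = 2 := by omega
    · simpa using hx
    · simpa using hb
  | succ k ih =>
    obtain ⟨hv, t, ht, hne⟩ := h
    obtain ⟨c, h1, h2, h3, h4, h5, h6⟩ := ih ht
    have hc : ∀ i, i ≤ k + 2 → Function.update c (k + 3) v i = c i := fun i hi => by
      rw [Function.update_of_ne (by omega)]
    have hc' : Function.update c (k + 3) v (k + 3) = v := by simp
    refine ⟨Function.update c (k + 3) v, ?_, ?_, ?_, hc', ?_, ?_⟩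
    · rw [hc 1 (by omega), h1]
    · rw [hc 2 (by omega), h2]
    · rw [hc (k + 1 + 1) (by omega)]; exact h4
    · intro i hi hi'
      rcases Nat.lt_or_ge i (k + 3) with h | h
      · rw [hc i (by omega)]; exact h5 i hi (by omega)
      · obtain rfl : i = k + 3 := by omega
        rw [hc']; exact hv
    · intro i hi
      rw [hc (i + 1) (by omega), hc (i + 2) (by omega)]
      rcases Nat.lt_or_ge i k with h | h
      · rw [hc (i + 3) (by omega)]; exact h6 i h
      · obtain rfl : i = k := by omega
        rw [hc', h3, h4]; exact hne

variable {m : ℕ}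

/-- To win, vertex `0` has to be right on everything that no other vertex guesses. -/
theorem SeqWin.guess_eq (hw : SeqWin (m + 3) H F) (hF : ∀ i, F (i + (m + 3)) = F i)
    (hH : ∀ i, H (i + (m + 3)) = H i) {t u v : ℕ} (ht : t < H 0) (hx : x < H 1) (hb : b < H 2)
    (hr : Reach F H x b m u v) (h1 : F 1 t b ≠ x) (h2 : F (m + 2) u t ≠ v) : F 0 v x = t := by
  obtain ⟨c, c1, c2, c3, c4, c5, c6⟩ := exists_coloring_of_reach hr hx hb
  have hmod : ∀ i, i % (m + 3) < m + 3 := fun i => Nat.mod_lt _ (by omega)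
  obtain ⟨i, hi⟩ := hw (fun i => if i % (m + 3) = 0 then t else c (i % (m + 3)))
    (fun i => by simp) (fun i => by
      rw [← eq_of_mod_eq hH (Nat.mod_mod i (m + 3))]
      have := hmod i
      split_ifs with h
      · rwa [h]
      · exact c5 _ (by omega) (by omega))
  rw [← eq_of_mod_eq hF (Nat.mod_mod (i + 1) (m + 3))] at hi
  have e1 : (i + 1) % (m + 3) = (i % (m + 3) + 1) % (m + 3) := by simp
  have e2 : (i + 2) % (m + 3) = (i % (m + 3) + 2) % (m + 3) := by simp
  rw [e1, e2] at hi
  have hlt := hmod i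
  generalize i % (m + 3) = j at hi hlt
  rcases Nat.lt_or_ge (j + 2) (m + 3) with h | h
  · rw [Nat.mod_eq_of_lt h, Nat.mod_eq_of_lt (show j + 1 < m + 3 by omega)] at hi
    rcases Nat.eq_zero_or_pos j with rfl | hj
    · simp [c1, c2] at hi
      exact absurd hi h1
    · obtain ⟨j, rfl⟩ : ∃ i, j = i + 1 := ⟨j - 1, by omega⟩
      simp at hi
      exact absurd hi (c6 j (by omega))
  · obtain rfl | rfl : j = m + 1 ∨ j = m + 2 := by omega
    · have e : (m + 1 + 2) % (m + 3) = 0 := Nat.mod_self _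
      have e' : (m + 1 + 1) % (m + 3) = m + 2 := Nat.mod_eq_of_lt (by omega)
      simp [e, e', c3, c4] at hi
      exact absurd hi h2
    · have e : (m + 2 + 2) % (m + 3) = 1 := by
        rw [show m + 2 + 2 = 1 + (m + 3) by omega, Nat.add_mod_right, Nat.mod_eq_of_lt (by omega)]
      have e' : (m + 2 + 1) % (m + 3) = 0 := Nat.mod_self _
      simpa [e, e', c4, c1] using hi

/-- The number of colors `t < q` of vertex `0` for which vertex `1` guesses `x` when vertex `2` has
color `b`. -/
def blocked (F : ℕ → ℕ → ℕ → ℕ) (q b x : ℕ) : ℕ :=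
  ((Finset.range q).filter fun t => F 1 t b = x).card

theorem blocked_add_alive (F : ℕ → ℕ → ℕ → ℕ) (q b x : ℕ) :
    blocked F q b x + ((Finset.range q).filter fun t => F 1 t b ≠ x).card = q := by
  rw [blocked, Finset.card_filter_add_card_filter_not, Finset.card_range]

theorem sum_card_fiber_le (f : ℕ → ℕ) (q : ℕ) (s : Finset ℕ) :
    ∑ x ∈ s, ((Finset.range q).filter fun t => f t = x).card ≤ q := by
  simp only [Finset.card_filter]
  rw [Finset.sum_comm]
  calc _ ≤ ∑ _t ∈ Finset.range q, 1 := Finset.sum_le_sum fun t _ => by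
        rw [Finset.sum_ite_eq]; split_ifs <;> simp
    _ = q := by simp

theorem sum_blocked_le (F : ℕ → ℕ → ℕ → ℕ) (q b : ℕ) (s : Finset ℕ) :
    ∑ x ∈ s, blocked F q b x ≤ q :=
  sum_card_fiber_le (fun t => F 1 t b) q s

theorem SeqWin.le_blocked_of_fork (hw : SeqWin (m + 3) H F) (hF : ∀ i, F (i + (m + 3)) = F i)
    (hH : ∀ i, H (i + (m + 3)) = H i) (hx : x < H 1) (hb : b < H 2) (hf : Fork F H x b m)
    {q : ℕ} (hq : q ≤ H 0) : q ≤ blocked F q b x + 2 := by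
  obtain ⟨u, v, v', hne, hv, hv'⟩ := hf
  have hsub : ((Finset.range q).filter fun t => F 1 t b ≠ x) ⊆ {F 0 v x, F 0 v' x} := by
    intro t ht
    simp only [Finset.mem_filter, Finset.mem_range] at ht
    rw [Finset.mem_insert, Finset.mem_singleton]
    by_cases h : F (m + 2) u t = v
    · right
      exact (hw.guess_eq hF hH (ht.1.trans_le hq) hx hb hv' ht.2
        (fun h' => hne (h.symm.trans h'))).symm
    · left
      exact (hw.guess_eq hF hH (ht.1.trans_le hq) hx hb hv ht.2 h).symm
  have h1 := (Finset.card_le_card hsub).trans Finset.card_le_two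
  have h2 := blocked_add_alive F q b x
  omega

theorem SeqWin.le_blocked_of_trident (hw : SeqWin (m + 3) H F) (hF : ∀ i, F (i + (m + 3)) = F i)
    (hH : ∀ i, H (i + (m + 3)) = H i) (hx : x < H 1) (hb : b < H 2) (hf : Trident F H x b m)
    {q : ℕ} (hq : q ≤ H 0) : q ≤ blocked F q b x + 1 := by
  have h1 : ((Finset.range q).filter fun t => F 1 t b ≠ x).card ≤ 1 := by
    refine Finset.card_le_one.2 fun t ht t' ht' => ?_
    simp only [Finset.mem_filter, Finset.mem_range] at ht ht'
    obtain ⟨v₁, v₂, v₃, h12, h13, h23, ⟨u, hu, hu'⟩, ⟨s, hs, hs'⟩, r, hr, hr'⟩ := hf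
    have key : ∀ t, t < q → F 1 t b ≠ x →
        (F 0 v₁ x = t ∧ F 0 v₂ x = t) ∨ (F 0 v₁ x = t ∧ F 0 v₃ x = t) ∨
        (F 0 v₂ x = t ∧ F 0 v₃ x = t) := by
      intro t ht htx
      have two : ∀ {u v v'}, v ≠ v' → Reach F H x b m u v → Reach F H x b m u v' →
          F 0 v x = t ∨ F 0 v' x = t := by
        intro u v v' hne hv hv'
        by_cases h : F (m + 2) u t = v
        · exact Or.inr (hw.guess_eq hF hH (ht.trans_le hq) hx hb hv' htx
            fun h' => hne (h.symm.trans h'))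
        · exact Or.inl (hw.guess_eq hF hH (ht.trans_le hq) hx hb hv htx h)
      have a1 := two h12 hu hu'
      have a2 := two h13 hs hs'
      have a3 := two h23 hr hr'
      tauto
    have k1 := key t ht.1 ht.2
    have k2 := key t' ht'.1 ht'.2
    omega
  have h2 := blocked_add_alive F q b x
  omega

end Front

theorem exists_half {q : ℕ} (f : ℕ → ℕ) :
    ∃ b < 2, q ≤ 2 * ((Finset.range q).filter fun w => f w ≠ b).card := by
  have h : Finset.range q ⊆ ((Finset.range q).filter fun w => f w ≠ 0) ∪
      ((Finset.range q).filter fun w => f w ≠ 1) := by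
    intro w hw
    rw [Finset.mem_union, Finset.mem_filter, Finset.mem_filter]
    by_cases h0 : f w = 0
    · exact Or.inr ⟨hw, by omega⟩
    · exact Or.inl ⟨hw, h0⟩
  have h' := (Finset.card_le_card h).trans (Finset.card_union_le _ _)
  rw [Finset.card_range] at h'
  rcases le_total ((Finset.range q).filter fun w => f w ≠ 0).card
    ((Finset.range q).filter fun w => f w ≠ 1).card with h1 | h1
  · exact ⟨1, by omega, by omega⟩
  · exact ⟨0, by omega, by omega⟩

theorem exists_shared_slot {F : ℕ → ℕ → ℕ → ℕ} {q d r : ℕ}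
    (h : ∀ x < r, ∃ b < 2, d ≤ blocked F q b x) : ∃ s, r ≤ 2 * s ∧ s * d ≤ q := by
  classical
  let S (b : ℕ) := (Finset.range r).filter fun x => d ≤ blocked F q b x
  have hS : ∀ b, (S b).card * d ≤ q := fun b => by
    refine le_trans ?_ (sum_blocked_le F q b (S b))
    rw [← smul_eq_mul]
    exact Finset.card_nsmul_le_sum _ _ _ fun x hx => (Finset.mem_filter.1 hx).2
  have hcov : Finset.range r ⊆ S 0 ∪ S 1 := by
    intro x hx
    obtain ⟨b, hb, hbx⟩ := h x (Finset.mem_range.1 hx)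
    rw [Finset.mem_union, Finset.mem_filter, Finset.mem_filter]
    obtain rfl | rfl : b = 0 ∨ b = 1 := by omega
    · exact Or.inl ⟨hx, hbx⟩
    · exact Or.inr ⟨hx, hbx⟩
  have h' := (Finset.card_le_card hcov).trans (Finset.card_union_le _ _)
  rw [Finset.card_range] at h'
  rcases le_total (S 0).card (S 1).card with h1 | h1
  · exact ⟨_, by omega, hS 1⟩
  · exact ⟨_, by omega, hS 0⟩

/-- The front reached at positions `k + 1`, `k + 2` is a trident, or it is a fork and there has
been no hatness above `4` since the last hatness `2`. -/
def MixedFront (F : ℕ → ℕ → ℕ → ℕ) (H : ℕ → ℕ) (x b k : ℕ) : Prop :=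
  Trident F H x b k ∨ Fork F H x b k ∧
    ∃ p, 2 ≤ p ∧ p ≤ k + 2 ∧ H p = 2 ∧ ∀ j, p < j → j ≤ k + 2 → H j < 5

section Mixed

variable {F : ℕ → ℕ → ℕ → ℕ} {H : ℕ → ℕ} {m : ℕ}

theorem MixedFront.fork {x b k : ℕ} (h : MixedFront F H x b k) : Fork F H x b k :=
  h.elim Trident.fork And.left

theorem MixedFront.succ {x b k : ℕ} (h2 : ∀ i, 2 ≤ H i)
    (hsep : ∀ p r, p < r → r < p + (m + 3) → H p = 2 → H r = 2 → ∃ j, p < j ∧ j < r ∧ 5 ≤ H j)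
    (hk : k < m) (h : MixedFront F H x b k) :
    MixedFront F H x b (k + 1) := by
  rcases eq_or_ne (H (k + 3)) 2 with he | he
  · refine Or.inr ⟨?_, k + 3, by omega, by omega, he, by omega⟩
    rcases h with h | ⟨-, p, hp2, hpk, hp, hlt⟩
    · exact h.fork_succ he.ge
    · obtain ⟨j, hj, hj', hj5⟩ := hsep p (k + 3) (by omega) (by omega) hp he
      have := hlt j hj (by omega)
      omega
  · have h3 : 3 ≤ H (k + 3) := by have := h2 (k + 3); omega
    rcases h with h | ⟨h, p, hp2, hpk, hp, hlt⟩
    · exact Or.inl (h.trident_succ h3)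
    · by_cases h5 : 5 ≤ H (k + 3)
      · exact Or.inl (h.trident_succ h5)
      · refine Or.inr ⟨h.fork_succ h3, p, hp2, by omega, hp, fun j hj hj' => ?_⟩
        rcases Nat.lt_or_ge j (k + 3) with hjk | hjk
        · exact hlt j hj (by omega)
        · obtain rfl : j = k + 3 := by omega
          omega

theorem exists_mixedFront (h2 : ∀ i, 2 ≤ H i)
    (hsep : ∀ p r, p < r → r < p + (m + 3) → H p = 2 → H r = 2 → ∃ j, p < j ∧ j < r ∧ 5 ≤ H j)
    (hm : 1 ≤ m) (hH2 : H 2 = 2) (x : ℕ) :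
    ∃ b < 2, MixedFront F H x b m := by
  have h3 : H 3 ≠ 2 := fun h3 => by
    obtain ⟨j, hj, hj', -⟩ := hsep 2 3 (by omega) (by omega) hH2 h3
    omega
  have h3' := h2 3
  have hstart : ∃ b < 2, MixedFront F H x b 1 := by
    by_cases h5 : 5 ≤ H 3
    · obtain ⟨b, hb, hbc⟩ := exists_half (q := 5) (F 2 x)
      exact ⟨b, hb, Or.inl (trident_one h5 (by omega))⟩
    · obtain ⟨b, hb, hbc⟩ := exists_half (q := 3) (F 2 x)
      refine ⟨b, hb, Or.inr ⟨fork_one (q := 3) (by omega) (by omega), 2, le_rfl, by omega, hH2,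
        fun j hj hj' => ?_⟩⟩
      obtain rfl : j = 3 := by omega
      omega
  obtain ⟨b, hb, h⟩ := hstart
  refine ⟨b, hb, ?_⟩
  have : ∀ k, 1 ≤ k → k ≤ m → MixedFront F H x b k := by
    intro k hk
    induction k, hk using Nat.le_induction with
    | base => exact fun _ => h
    | succ k _ ih => exact fun hkm => (ih (by omega)).succ h2 hsep (by omega)
  exact this m hm le_rfl

theorem not_seqWin_mixed (h2 : ∀ i, 2 ≤ H i)
    (hsep : ∀ p r, p < r → r < p + (m + 3) → H p = 2 → H r = 2 → ∃ j, p < j ∧ j < r ∧ 5 ≤ H j)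
    (hm : 1 ≤ m) (hF : ∀ i, F (i + (m + 3)) = F i)
    (hH : ∀ i, H (i + (m + 3)) = H i) (hH2 : H 2 = 2) (h5 : ∃ j, 5 ≤ H j)
    (hnbr : H 1 < 5 ∨ ∀ i, H i = 2 → 5 ≤ H (i + 1) ∧ 5 ≤ H (i + (m + 2))) :
    ¬ SeqWin (m + 3) H F := by
  intro hw
  have h1 : 3 ≤ H 1 := by
    by_contra hlt
    obtain ⟨j, hj, hj', -⟩ := hsep 1 2 (by omega) (by omega) (by have := h2 1; omega) hH2
    omega
  by_cases h05 : 5 ≤ H 0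
  · obtain ⟨s, hs, hs'⟩ := exists_shared_slot (F := F) (q := 5) (d := 3) (r := 3) fun x hx => by
      obtain ⟨b, hb, hf⟩ := exists_mixedFront (F := F) h2 hsep hm hH2 x
      have := hw.le_blocked_of_fork hF hH (by omega) (by omega) hf.fork h05
      exact ⟨b, hb, by omega⟩
    omega
  have htri : ∀ x, ∃ b < 2, Trident F H x b m := by
    intro x
    obtain ⟨b, hb, hf | ⟨-, p, hp2, hpm, hp, hlt⟩⟩ := exists_mixedFront (F := F) h2 hsep hm hH2 x
    · exact ⟨b, hb, hf⟩
    exfalso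
    have hwrap : H (m + 3) = H 0 := by simpa using hH 0
    rcases hnbr with h15 | hnbr
    · have hwrap1 : H (m + 4) = H 1 := by rw [← hH 1]; congr 1; omega
      have hwrap2 : H (m + 5) = H 2 := by rw [← hH 2]; congr 1; omega
      rcases hp2.eq_or_lt with rfl | hp2
      · obtain ⟨j, hj⟩ := h5
        rw [← eq_of_mod_eq hH (Nat.mod_mod j (m + 3))] at hj
        have hjlt := Nat.mod_lt j (show m + 3 > 0 by omega)
        generalize j % (m + 3) = j at hj hjlt
        obtain rfl | rfl | rfl | hj2 : j = 0 ∨ j = 1 ∨ j = 2 ∨ 2 < j := by omega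
        · omega
        · omega
        · omega
        · have := hlt j hj2 (by omega)
          omega
      · obtain ⟨j, hj, hj', hj5⟩ := hsep p (m + 5) (by omega) (by omega) hp (by omega)
        obtain hj2 | rfl | rfl : j ≤ m + 2 ∨ j = m + 3 ∨ j = m + 4 := by omega
        · have := hlt j hj hj2
          omega
        · omega
        · omega
    · have := (hnbr p hp).1
      rcases hpm.eq_or_lt with rfl | hpm
      · rw [show m + 2 + 1 = m + 3 by omega] at this
        omega
      · have := hlt (p + 1) (by omega) (by omega)
        omega
  by_cases h02 : H 0 = 2
  · have h15 : 5 ≤ H 1 := by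
      obtain ⟨j, hj, hj', hj5⟩ := hsep 0 2 (by omega) (by omega) h02 hH2
      obtain rfl : j = 1 := by omega
      exact hj5
    obtain ⟨s, hs, hs'⟩ := exists_shared_slot (F := F) (q := 2) (d := 1) (r := 5) fun x hx => by
      obtain ⟨b, hb, hf⟩ := htri x
      have := hw.le_blocked_of_trident hF hH (by omega) (by omega) hf h02.ge
      exact ⟨b, hb, by omega⟩
    omega
  · obtain ⟨s, hs, hs'⟩ := exists_shared_slot (F := F) (q := 3) (d := 2) (r := 3) fun x hx => by
      obtain ⟨b, hb, hf⟩ := htri x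
      have := hw.le_blocked_of_trident hF hH (q := 3) (by omega) (by omega) hf
        (by have := h2 0; omega)
      exact ⟨b, hb, by omega⟩
    omega

end Mixed

section Large

variable {F : ℕ → ℕ → ℕ → ℕ} {H : ℕ → ℕ} {m : ℕ}

theorem not_seqWin_single_two (hm : 1 ≤ m) (hF : ∀ i, F (i + (m + 3)) = F i)
    (hH : ∀ i, H (i + (m + 3)) = H i) (hH2 : H 2 = 2) (hH3 : 4 ≤ H 3)
    (h3 : ∀ i, 3 ≤ i → i ≤ m + 2 → 3 ≤ H i) {q r : ℕ} (hq : q ≤ H 0) (hr : r ≤ H 1)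
    (hq3 : 3 ≤ q) (hqr : 2 * q < r * (q - 1)) : ¬ SeqWin (m + 3) H F := by
  intro hw
  have hrow : ∀ x ∈ Finset.range r, q - 1 ≤ ∑ b ∈ Finset.range 2, blocked F q b x := by
    intro x hx
    have hx1 : x < H 1 := (Finset.mem_range.1 hx).trans_le hr
    have hfork : ∀ b < 2, 1 < ((Finset.range 4).filter fun w => F 2 x w ≠ b).card →
        q ≤ blocked F q b x + 2 := fun b hb h =>
      hw.le_blocked_of_fork hF hH hx1 (by omega)
        ((fork_one hH3 h).fork_of_le hm fun i hi hi' => h3 i (by omega) hi') hq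
    have htri : ∀ b < 2, 2 < ((Finset.range 4).filter fun w => F 2 x w ≠ b).card →
        q ≤ blocked F q b x + 1 := fun b hb h =>
      hw.le_blocked_of_trident hF hH hx1 (by omega)
        ((trident_one hH3 h).trident_of_le hm fun i hi hi' => h3 i (by omega) hi') hq
    have hcount : ∀ b, ((Finset.range 4).filter fun w => F 2 x w = b).card +
        ((Finset.range 4).filter fun w => F 2 x w ≠ b).card = 4 := fun b => by
      rw [Finset.card_filter_add_card_filter_not, Finset.card_range]
    have hsum := sum_card_fiber_le (F 2 x) 4 (Finset.range 2)
    rw [Finset.sum_range_succ, Finset.sum_range_one] at hsum ⊢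
    have a0 := hfork 0 (by omega)
    have a1 := hfork 1 (by omega)
    have b0 := htri 0 (by omega)
    have b1 := htri 1 (by omega)
    have c0 := hcount 0
    have c1 := hcount 1
    omega
  have h1 := Finset.card_nsmul_le_sum _ _ _ hrow
  rw [Finset.sum_comm] at h1
  have h4 := h1.trans (Finset.sum_le_sum fun b _ => sum_blocked_le F q b (Finset.range r))
  simp only [Finset.card_range, smul_eq_mul, Finset.sum_const] at h4
  omega

theorem blocked_of_three_le (hm : 1 ≤ m) (hF : ∀ i, F (i + (m + 3)) = F i)
    (hH : ∀ i, H (i + (m + 3)) = H i) (h3 : ∀ i, 3 ≤ H i) (hw : SeqWin (m + 3) H F)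
    {q b x : ℕ} (hq : q ≤ H 0) (hb : b < 3) (hx : x < 3) :
    (((Finset.range 3).filter fun w => F 2 x w = b).card ≤ 1 → q ≤ blocked F q b x + 2) ∧
    (((Finset.range 3).filter fun w => F 2 x w = b).card = 0 → q ≤ blocked F q b x + 1) := by
  have hcount : ((Finset.range 3).filter fun w => F 2 x w = b).card +
      ((Finset.range 3).filter fun w => F 2 x w ≠ b).card = 3 := by
    rw [Finset.card_filter_add_card_filter_not, Finset.card_range]
  have h1 := h3 1
  have h2 := h3 2
  constructor
  · intro h
    exact hw.le_blocked_of_fork hF hH (by omega) (by omega)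
      ((fork_one (h3 3) (by omega)).fork_of_le hm fun i _ _ => h3 i) hq
  · intro h
    exact hw.le_blocked_of_trident hF hH (by omega) (by omega)
      ((trident_one (h3 3) (by omega)).trident_of_le hm fun i _ _ => h3 i) hq

theorem not_seqWin_of_four_le (hm : 1 ≤ m) (hF : ∀ i, F (i + (m + 3)) = F i)
    (hH : ∀ i, H (i + (m + 3)) = H i) (h3 : ∀ i, 3 ≤ H i) (h4 : 4 ≤ H 0) :
    ¬ SeqWin (m + 3) H F := by
  intro hw
  have hrow : ∀ x ∈ Finset.range 3, 5 ≤ ∑ b ∈ Finset.range 3, blocked F 4 b x := by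
    intro x hx
    have key := fun b hb => blocked_of_three_le hm hF hH h3 hw (b := b) h4 hb
      (Finset.mem_range.1 hx)
    have hsum := sum_card_fiber_le (F 2 x) 3 (Finset.range 3)
    simp only [Finset.sum_range_succ, Finset.sum_range_zero] at hsum ⊢
    have k0 := key 0 (by omega)
    have k1 := key 1 (by omega)
    have k2 := key 2 (by omega)
    omega
  have h1 := Finset.card_nsmul_le_sum _ _ _ hrow
  rw [Finset.sum_comm] at h1
  have h5 := h1.trans (Finset.sum_le_sum fun b _ => sum_blocked_le F 4 b (Finset.range 3))
  simp only [Finset.card_range, smul_eq_mul, Finset.sum_const] at h5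
  omega

/-- On a cycle with all hatnesses `3`, the guesses of neighboring vertices balance exactly. -/
theorem balance_zero (hm : 1 ≤ m) (hF : ∀ i, F (i + (m + 3)) = F i)
    (hw : SeqWin (m + 3) (fun _ => 3) F) {b x : ℕ} (hb : b < 3) (hx : x < 3) :
    ((Finset.range 3).filter fun t => F 1 t b = x).card +
      ((Finset.range 3).filter fun w => F 2 x w = b).card = 2 := by
  let N (b x : ℕ) : ℕ := ((Finset.range 3).filter fun w => F 2 x w = b).card
  have key : ∀ b < 3, ∀ x < 3, 2 ≤ blocked F 3 b x + N b x := by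
    intro b hb x hx
    have := blocked_of_three_le hm hF (fun _ => rfl) (fun _ => le_rfl) hw le_rfl hb hx
    simp only [N]
    omega
  have hrow : ∀ x, ∑ b ∈ Finset.range 3, N b x ≤ 3 := fun x =>
    sum_card_fiber_le (F 2 x) 3 (Finset.range 3)
  have hcol : ∀ b, ∑ x ∈ Finset.range 3, blocked F 3 b x ≤ 3 := fun b =>
    sum_blocked_le F 3 b (Finset.range 3)
  change blocked F 3 b x + N b x = 2
  have r0 := hrow 0
  have r1 := hrow 1
  have r2 := hrow 2
  have c0 := hcol 0
  have c1 := hcol 1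
  have c2 := hcol 2
  simp only [Finset.sum_range_succ, Finset.sum_range_zero] at r0 r1 r2 c0 c1 c2
  have k00 := key 0 (by omega) 0 (by omega)
  have k01 := key 0 (by omega) 1 (by omega)
  have k02 := key 0 (by omega) 2 (by omega)
  have k10 := key 1 (by omega) 0 (by omega)
  have k11 := key 1 (by omega) 1 (by omega)
  have k12 := key 1 (by omega) 2 (by omega)
  have k20 := key 2 (by omega) 0 (by omega)
  have k21 := key 2 (by omega) 1 (by omega)
  have k22 := key 2 (by omega) 2 (by omega)
  interval_cases b <;> interval_cases x <;> omega

end Large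

section Three

/-- The guessing functions `G` win on a cycle of length `n` with all hatnesses `3`. -/
def CycWin (n : ℕ) (G : ℕ → ZMod 3 → ZMod 3 → ZMod 3) : Prop :=
  (∀ i, G (i + n) = G i) ∧ ∀ c : ℕ → ZMod 3, (∀ i, c (i + n) = c i) →
    ∃ i, G (i + 1) (c i) (c (i + 2)) = c (i + 1)

/-- Guessing functions on numerical colors. -/
def natGuess (G : ℕ → ZMod 3 → ZMod 3 → ZMod 3) (i a b : ℕ) : ℕ := (G i a b).val

/-- How often the vertex `v` guesses `x` when its left neighbor has color `a`. -/
def rowCount (G : ℕ → ZMod 3 → ZMod 3 → ZMod 3) (v : ℕ) (a x : ZMod 3) : ℕ :=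
  (Finset.univ.filter fun c => G v a c = x).card

/-- How often the vertex `v` guesses `x` when its right neighbor has color `b`. -/
def colCount (G : ℕ → ZMod 3 → ZMod 3 → ZMod 3) (v : ℕ) (b x : ZMod 3) : ℕ :=
  (Finset.univ.filter fun a => G v a b = x).card

variable {G : ℕ → ZMod 3 → ZMod 3 → ZMod 3} {m n : ℕ}

theorem sum_zmod_three (f : ZMod 3 → ℕ) : ∑ x, f x = f 0 + f 1 + f 2 :=
  Fin.sum_univ_three f

theorem forall_zmod_three {p : ZMod 3 → Prop} : (∀ x, p x) ↔ p 0 ∧ p 1 ∧ p 2 :=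
  ⟨fun h => ⟨h 0, h 1, h 2⟩, fun ⟨h0, h1, h2⟩ x => match x with | 0 => h0 | 1 => h1 | 2 => h2⟩

theorem card_fiber_eq (f : ZMod 3 → ZMod 3) (x : ZMod 3) :
    ((Finset.range 3).filter fun t : ℕ => (f t).val = x.val).card =
      (Finset.univ.filter fun t => f t = x).card := by
  rw [Finset.card_filter, Finset.card_filter, sum_zmod_three]
  simp only [Finset.sum_range_succ, Finset.sum_range_zero, (ZMod.val_injective 3).eq_iff]
  simp

theorem sum_rowCount (v : ℕ) (a : ZMod 3) : ∑ x, rowCount G v a x = 3 :=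
  Finset.sum_card_fiberwise_eq_card_filter _ _ _ |>.trans (by simp)

theorem sum_colCount (v : ℕ) (b : ZMod 3) : ∑ x, colCount G v b x = 3 :=
  Finset.sum_card_fiberwise_eq_card_filter _ _ _ |>.trans (by simp)

theorem cycWin_of_seqWin {F : ℕ → ℕ → ℕ → ℕ} (hF : ∀ i, F (i + n) = F i)
    (hw : SeqWin n (fun _ => 3) F) : CycWin n fun i a b => (F i a.val b.val : ZMod 3) := by
  refine ⟨fun i => by simp only [hF], fun c hc => ?_⟩
  obtain ⟨i, hi⟩ := hw (fun i => (c i).val) (fun i => by rw [hc]) fun i => ZMod.val_lt _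
  exact ⟨i, by simp only [hi, ZMod.natCast_zmod_val]⟩

theorem CycWin.seqWin (hG : CycWin n G) : SeqWin n (fun _ => 3) (natGuess G) := by
  intro c hc hlt
  obtain ⟨i, hi⟩ := hG.2 (fun i => (c i : ZMod 3)) fun i => by rw [hc]
  exact ⟨i, by rw [natGuess, hi, ZMod.val_natCast, Nat.mod_eq_of_lt (hlt _)]⟩

theorem natGuess_periodic (hG : CycWin n G) (i : ℕ) : natGuess G (i + n) = natGuess G i := by
  funext a b
  rw [natGuess, hG.1, natGuess]

theorem CycWin.shift (hn : 0 < n) (hG : CycWin n G) (s : ℕ) : CycWin n fun i => G (i + s) := by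
  have hs : (n - 1) * s + s = n * s := by
    rw [← Nat.succ_mul, Nat.succ_eq_add_one, Nat.sub_add_cancel hn]
  refine ⟨fun i => by simp only [Nat.add_right_comm i n s, hG.1], fun c hc => ?_⟩
  obtain ⟨i, hi⟩ := hG.2 (fun i => c (i + (n - 1) * s)) fun i => by
    rw [Nat.add_right_comm, hc]
  refine ⟨i + (n - 1) * s, ?_⟩
  have e : G (i + (n - 1) * s + 1 + s) = G (i + 1) :=
    eq_of_mod_eq hG.1 (by
      rw [show i + (n - 1) * s + 1 + s = i + 1 + n * s by omega, Nat.add_mul_mod_self_left])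
  beta_reduce
  rw [e, show i + (n - 1) * s + 2 = i + 2 + (n - 1) * s by omega, hi]
  congr 1
  omega

theorem CycWin.balance (hm : 1 ≤ m) (hG : CycWin (m + 3) G) (v : ℕ) (x b : ZMod 3) :
    colCount G v b x + rowCount G (v + 1) x b = 2 := by
  have hS := hG.shift (by omega) (v + (m + 2))
  have := balance_zero hm (natGuess_periodic hS) hS.seqWin (ZMod.val_lt b) (ZMod.val_lt x)
  simp only [natGuess, ZMod.natCast_zmod_val, card_fiber_eq] at this
  rw [show 1 + (v + (m + 2)) = v + (m + 3) by omega,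
    show 2 + (v + (m + 2)) = v + 1 + (m + 3) by omega, hG.1, hG.1,
    card_fiber_eq (fun t => G v t b)] at this
  exact this

theorem SeqWin.eq_of_reach {F : ℕ → ℕ → ℕ → ℕ} {H : ℕ → ℕ} {x b v t : ℕ}
    (hw : SeqWin (m + 3) H F) (hF : ∀ i, F (i + (m + 3)) = F i)
    (hH : ∀ i, H (i + (m + 3)) = H i) (hx : x < H 1) (hb : b < H 2)
    (hr : Reach F H x b (m + 1) v t) (h1 : F 1 t b ≠ x) : F 0 v x = t := by
  obtain ⟨ht, u, hu, hne⟩ := hr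
  exact hw.guess_eq hF hH (by rwa [← zero_add (m + 3), hH 0] at ht) hx hb hu h1 hne

theorem CycWin.colCount_of_rowCount (hm : 1 ≤ m) (hG : CycWin (m + 3) G) (v : ℕ) {x : ZMod 3}
    (h : ∀ b, rowCount G (v + 1) x b = 1) (a : ZMod 3) : rowCount G v a x = 1 := by
  have key : ∀ t, 1 ≤ colCount G (v + (m + 2)) x t := by
    intro t
    by_contra hcon
    have hno : ∀ y, G (v + (m + 2)) y x ≠ t := by
      simpa [colCount, Finset.filter_eq_empty_iff] using hcon
    have hall : ∀ b, G v t b = x := by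
      intro b
      by_contra hne
      have hS := hG.shift (by omega) (v + (m + 2))
      have hF := natGuess_periodic hS
      have e1 : G (1 + (v + (m + 2))) = G v := by
        rw [show 1 + (v + (m + 2)) = v + (m + 3) by omega, hG.1]
      have e2 : G (2 + (v + (m + 2))) = G (v + 1) := by
        rw [show 2 + (v + (m + 2)) = v + 1 + (m + 3) by omega, hG.1]
      have hfork : Fork (natGuess fun i => G (i + (v + (m + 2)))) (fun _ => 3) x.val b.val m := by
        refine (fork_one (q := 3) le_rfl ?_).fork_of_le hm fun _ _ _ => le_rfl
        have h1 := h b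
        rw [rowCount, ← e2, ← card_fiber_eq] at h1
        have h2 := Finset.card_filter_add_card_filter_not (s := Finset.range 3)
          (fun w : ℕ => (G (2 + (v + (m + 2))) x w).val = b.val)
        rw [h1, Finset.card_range] at h2
        simp only [natGuess, ZMod.natCast_zmod_val]
        change _ + ((Finset.range 3).filter _).card = 3 at h2
        simp only [ne_eq]
        omega
      obtain ⟨u, y, y', hyy, hy, hy'⟩ := hfork
      have hne' : natGuess (fun i => G (i + (v + (m + 2)))) 1 t.val b.val ≠ x.val := by
        simpa [natGuess, e1, (ZMod.val_injective 3).eq_iff] using hne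
      have fin : ∀ y : ℕ, Reach (natGuess fun i => G (i + (v + (m + 2)))) (fun _ => 3) x.val b.val
          (m + 1) y t.val → False := by
        intro y hy
        have := hS.seqWin.eq_of_reach hF (fun _ => rfl) (ZMod.val_lt x) (ZMod.val_lt b) hy hne'
        simp only [natGuess, ZMod.natCast_zmod_val, (ZMod.val_injective 3).eq_iff, zero_add] at this
        exact hno _ this
      rcases reach_step hy hy' hyy (ZMod.val_lt t) with h | h <;> exact fin _ h
    have h1 := hG.balance hm (v + (m + 2)) t x
    have h2 : rowCount G v t x = 3 := by simp [rowCount, hall]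
    rw [show v + (m + 2) + 1 = v + (m + 3) by omega, rowCount, hG.1] at h1
    rw [rowCount] at h2
    omega
  have hsum := sum_colCount (G := G) (v + (m + 2)) x
  have hbal := hG.balance hm (v + (m + 2)) a x
  rw [show v + (m + 2) + 1 = v + (m + 3) by omega, rowCount, hG.1] at hbal
  rw [sum_zmod_three] at hsum
  rw [forall_zmod_three] at key
  have ha : colCount G (v + (m + 2)) x a = 1 := by
    revert a
    rw [forall_zmod_three]
    omega
  rw [rowCount]
  omega

theorem CycWin.false_of_rowCount (hm : 2 ≤ m) (hG : CycWin (m + 3) G) {b e : ZMod 3}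
    (hb : ∀ x, rowCount G 3 b x = 1) (he : ∀ x, rowCount G 5 e x = 1) : False := by
  have hm1 : 1 ≤ m := by omega
  have hF := natGuess_periodic hG
  obtain ⟨x, hx⟩ : ∃ x, G 2 x (G 3 b e) = b := by
    have h1 : _ + rowCount G 3 b (G 3 b e) = 2 := hG.balance hm1 2 b (G 3 b e)
    have h2 := hb (G 3 b e)
    have h3 : 0 < colCount G 2 (G 3 b e) b := by omega
    obtain ⟨x, hx⟩ := Finset.card_pos.1 h3
    exact ⟨x, (Finset.mem_filter.1 hx).2⟩
  have hxb := hG.colCount_of_rowCount hm1 2 hb x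
  have hreach : ∀ d, d ≠ G 3 b e →
      Reach (natGuess G) (fun _ => 3) x.val b.val 2 d.val e.val := by
    intro d hd
    refine ⟨ZMod.val_lt e, b.val, reach_one (ZMod.val_lt d) ?_, ?_⟩
    · simp only [natGuess, ZMod.natCast_zmod_val, ne_eq, (ZMod.val_injective 3).eq_iff]
      intro h
      exact hd (Finset.card_le_one.1 hxb.le _ (by simpa using h) _ (by simpa using hx))
    · simpa only [natGuess, ZMod.natCast_zmod_val, ne_eq, (ZMod.val_injective 3).eq_iff] using
        hd.symm
  have hall : ∀ f : ZMod 3, Reach (natGuess G) (fun _ => 3) x.val b.val 3 e.val f.val := by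
    intro f
    obtain ⟨d, hd, hde⟩ : ∃ d, d ≠ G 3 b e ∧ G 4 d f ≠ e := by
      by_contra hcon
      push Not at hcon
      have h1 := hG.balance hm1 4 e f
      have h2 : colCount G 4 f e ≤ 1 := by
        rw [he] at h1
        omega
      have hne : ∀ y : ZMod 3, y + 1 ≠ y ∧ y + 2 ≠ y ∧ y + 1 ≠ y + 2 := by decide
      have hy := hne (G 3 b e)
      exact hy.2.2 (Finset.card_le_one.1 h2 _
        (by simpa using hcon _ hy.1) _ (by simpa using hcon _ hy.2.1))
    refine ⟨ZMod.val_lt f, d.val, hreach d hd, ?_⟩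
    simpa only [natGuess, ZMod.natCast_zmod_val, ne_eq, (ZMod.val_injective 3).eq_iff] using hde
  have htri : Trident (natGuess G) (fun _ => 3) x.val b.val 3 :=
    ⟨(0 : ZMod 3).val, (1 : ZMod 3).val, (2 : ZMod 3).val, by decide, by decide, by decide,
      ⟨_, hall 0, hall 1⟩, ⟨_, hall 0, hall 2⟩, _, hall 1, hall 2⟩
  obtain ⟨y₁, y₂, y₃, h12, h13, h23, ⟨u, hu⟩, ⟨u', hu'⟩, u'', hu''⟩ :=
    htri.trident_of_le (m := m + 1) (by omega) fun _ _ _ => le_rfl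
  have hpair : ∀ {u y y'}, y ≠ y' → Reach (natGuess G) (fun _ => 3) x.val b.val (m + 1) u y →
      Reach (natGuess G) (fun _ => 3) x.val b.val (m + 1) u y' →
      natGuess G 1 y b.val = x.val ∨ natGuess G 1 y' b.val = x.val := by
    intro u y y' hne hy hy'
    by_contra! hcon
    exact hne ((hG.seqWin.eq_of_reach hF (fun _ => rfl) (ZMod.val_lt x) (ZMod.val_lt b) hy
      hcon.1).symm.trans (hG.seqWin.eq_of_reach hF (fun _ => rfl) (ZMod.val_lt x) (ZMod.val_lt b)
      hy' hcon.2))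
  have hcard : ((Finset.range 3).filter fun t => natGuess G 1 t b.val = x.val).card ≤ 1 := by
    have h1 : colCount G 1 b x + rowCount G 2 x b = 2 := hG.balance hm1 1 x b
    rw [colCount, ← card_fiber_eq, hxb] at h1
    simp only [natGuess, ZMod.natCast_zmod_val]
    omega
  have honly : ∀ {u u' y y'}, Reach (natGuess G) (fun _ => 3) x.val b.val (m + 1) u y →
      Reach (natGuess G) (fun _ => 3) x.val b.val (m + 1) u' y' →
      natGuess G 1 y b.val = x.val → natGuess G 1 y' b.val = x.val → y = y' :=
    fun hy hy' h h' => Finset.card_le_one.1 hcard _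
      (Finset.mem_filter.2 ⟨Finset.mem_range.2 hy.1, h⟩) _
      (Finset.mem_filter.2 ⟨Finset.mem_range.2 hy'.1, h'⟩)
  have a1 := hpair h12 hu.1 hu.2
  have a2 := hpair h13 hu'.1 hu'.2
  have a3 := hpair h23 hu''.1 hu''.2
  have b1 := honly hu.1 hu.2
  have b2 := honly hu'.1 hu'.2
  have b3 := honly hu''.1 hu''.2
  tauto

theorem exists_rowCount_eq_one (hm : 1 ≤ m) (hG : CycWin (m + 3) G) (v : ℕ) {x : ZMod 3}
    (h : ∀ a, rowCount G (v + 1) a x = 1) : ∃ a, ∀ y, rowCount G (v + 1) a y = 1 := by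
  have hrow := fun a => sum_rowCount (G := G) (v + 1) a
  have hcol : ∀ y, rowCount G (v + 1) 0 y + rowCount G (v + 1) 1 y + rowCount G (v + 1) 2 y = 3 := by
    intro y
    have h1 := sum_colCount (G := G) v y
    have h2 := fun a => hG.balance hm v a y
    rw [sum_zmod_three] at h1
    rw [forall_zmod_three] at h2
    omega
  have hle : ∀ a y, rowCount G (v + 1) a y ≤ 2 := fun a y => by
    have := hG.balance hm v a y
    omega
  simp only [sum_zmod_three] at hrow
  by_contra hcon
  push Not at hcon
  simp only [← not_forall] at hcon
  revert x
  simp only [forall_zmod_three] at hrow hcol hle hcon ⊢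
  omega

/-- No vertex can guess all three colors equally often against a color of its left neighbor. -/
theorem CycWin.not_forall_rowCount (hm : 2 ≤ m) (hG : CycWin (m + 3) G) (v : ℕ) (x : ZMod 3) :
    ¬ ∀ y, rowCount G v x y = 1 := by
  intro h
  have hm1 : 1 ≤ m := by omega
  have hprev : ∀ v, (∃ a, ∀ y, rowCount G (v + 1 + 1) a y = 1) →
      ∃ a, ∀ y, rowCount G (v + 1) a y = 1 := fun v ⟨a, ha⟩ =>
    exists_rowCount_eq_one hm1 hG v (hG.colCount_of_rowCount hm1 (v + 1) ha)
  have hback : ∀ k v, (∃ a, ∀ y, rowCount G (v + k + 1) a y = 1) →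
      ∃ a, ∀ y, rowCount G (v + 1) a y = 1 := by
    intro k
    induction k with
    | zero => exact fun _ h => h
    | succ k ih => exact fun v hv => ih v (hprev (v + k) hv)
  have hper : ∀ k, rowCount G (v + k * (m + 3)) = rowCount G v := fun k => by
    have e : G (v + k * (m + 3)) = G v := eq_of_mod_eq hG.1 (by simp)
    funext a y
    rw [rowCount, e, rowCount]
  have hall : ∀ w, ∃ a, ∀ y, rowCount G (w + 1) a y = 1 := by
    intro w
    have hw : w + 1 ≤ v + (w + 1) * (m + 3) := by nlinarith
    refine hback (v + (w + 1) * (m + 3) - (w + 1)) w ⟨x, ?_⟩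
    rw [show w + (v + (w + 1) * (m + 3) - (w + 1)) + 1 = v + (w + 1) * (m + 3) by omega, hper]
    exact h
  obtain ⟨b, hb⟩ := hall 2
  obtain ⟨e, he⟩ := hall 4
  exact hG.false_of_rowCount hm hb he


end Three

theorem ZMod.three_affine {f : ZMod 3 → ZMod 3} (hf : f.Injective) (x : ZMod 3) :
    f x = (f 1 - f 0) * x + f 0 ∧ (f 1 - f 0) * (f 1 - f 0) = 1 := by
  have key : ∀ p q r : ZMod 3, p ≠ q → p ≠ r → q ≠ r →
      r = (q - p) * 2 + p ∧ (q - p) * (q - p) = 1 := by decide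
  obtain ⟨h1, h2⟩ := key (f 0) (f 1) (f 2) (hf.ne (by decide)) (hf.ne (by decide))
    (hf.ne (by decide))
  refine ⟨?_, h2⟩
  revert x
  rw [forall_zmod_three]
  exact ⟨by ring, by ring, h1⟩

/-- Every Latin square of order three is affine. -/
theorem ZMod.three_latin {P : ZMod 3 → ZMod 3 → ZMod 3} (hr : ∀ a, (P a).Injective)
    (hc : ∀ x, Function.Injective fun a => P a x) (a x : ZMod 3) :
    P a x = (P 1 0 - P 0 0) * a + (P 0 1 - P 0 0) * x + P 0 0 := by
  have key : ∀ p q s t : ZMod 3, s * s = 1 → t * t = 1 →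
      (∀ y, s * y + p ≠ t * y + q) → s = t := by decide
  have hs : P a 1 - P a 0 = P 0 1 - P 0 0 := by
    by_cases ha : a = 0
    · rw [ha]
    · have hne : ∀ y, (P a 1 - P a 0) * y + P a 0 ≠ (P 0 1 - P 0 0) * y + P 0 0 := fun y h =>
        ha (hc y (by simpa only [← (ZMod.three_affine (hr _) y).1] using h))
      exact key _ _ _ _ (ZMod.three_affine (hr a) 0).2 (ZMod.three_affine (hr 0) 0).2 hne
  rw [(ZMod.three_affine (hr a) x).1, hs, (ZMod.three_affine (hc 0) a).1]
  ring

theorem cast_injective_of_ne_one {f : ZMod 3 → ℕ} (h2 : ∀ x, f x ≤ 2)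
    (hsum : f 0 + f 1 + f 2 = 3) (h : ¬ ∀ x, f x = 1) :
    Function.Injective fun x => (f x : ZMod 3) := by
  have hval : ∀ x, ((f x : ZMod 3)).val = f x := fun x => by
    have := h2 x
    rw [ZMod.val_natCast, Nat.mod_eq_of_lt (by omega)]
  intro x y hxy
  have hf : f x = f y := by rw [← hval x, ← hval y]; exact congrArg ZMod.val hxy
  rw [forall_zmod_three] at h h2
  revert x y
  simp only [forall_zmod_three]
  grind

section Balanced

variable {G : ℕ → ZMod 3 → ZMod 3 → ZMod 3} {m : ℕ}

theorem CycWin.sum_rowCount_col (hm : 1 ≤ m) (hG : CycWin (m + 3) G) (v : ℕ) (y : ZMod 3) :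
    rowCount G (v + 1) 0 y + rowCount G (v + 1) 1 y + rowCount G (v + 1) 2 y = 3 := by
  have h1 := sum_colCount (G := G) v y
  have h2 := fun a => hG.balance hm v a y
  rw [sum_zmod_three] at h1
  rw [forall_zmod_three] at h2
  omega

theorem CycWin.rowCount_latin (hm : 2 ≤ m) (hG : CycWin (m + 3) G) (v : ℕ) :
    (∀ a, Function.Injective fun x => (rowCount G (v + 1) a x : ZMod 3)) ∧
    ∀ x, Function.Injective fun a => (rowCount G (v + 1) a x : ZMod 3) := by
  have hm1 : 1 ≤ m := by omega
  have hle : ∀ a y, rowCount G (v + 1) a y ≤ 2 := fun a y => by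
    have := hG.balance hm1 v a y
    omega
  refine ⟨fun a => cast_injective_of_ne_one (hle a) ?_ (hG.not_forall_rowCount hm _ a),
    fun x => cast_injective_of_ne_one (fun a => hle a x) (hG.sum_rowCount_col hm1 v x) fun h => ?_⟩
  · rw [← sum_zmod_three (fun x => rowCount G (v + 1) a x), sum_rowCount]
  · obtain ⟨a, ha⟩ := exists_rowCount_eq_one hm1 hG v h
    exact hG.not_forall_rowCount hm _ a ha

/-- The guess `G (v + 1) a c` is wrong for colorings on which `rowCount` is constant. -/
theorem CycWin.rowCount_ne (hm : 2 ≤ m) (hG : CycWin (m + 3) G) (v : ℕ) (a c : ZMod 3) :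
    rowCount G (v + 1) a (G (v + 1) a c) ≠ rowCount G (v + 2) (G (v + 1) a c) c := by
  have hm1 : 1 ≤ m := by omega
  generalize hx : G (v + 1) a c = x
  have h1 : ¬ ∀ a, rowCount G (v + 1) a x = 1 := fun h => by
    obtain ⟨a, ha⟩ := exists_rowCount_eq_one hm1 hG v h
    exact hG.not_forall_rowCount hm _ a ha
  have h2 := hG.not_forall_rowCount hm (v + 2) x
  have h3 : ∀ c, colCount G (v + 1) c x + rowCount G (v + 2) x c = 2 :=
    fun c => hG.balance hm1 (v + 1) x c
  have h4 := hG.sum_rowCount_col hm1 v x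
  set e : ZMod 3 → ZMod 3 → ℕ := fun a c => if G (v + 1) a c = x then 1 else 0 with he
  have hr : ∀ a, rowCount G (v + 1) a x = e a 0 + e a 1 + e a 2 := fun a => by
    rw [rowCount, Finset.card_filter, sum_zmod_three]
  have hc : ∀ c, colCount G (v + 1) c x = e 0 c + e 1 c + e 2 c := fun c => by
    rw [colCount, Finset.card_filter, sum_zmod_three]
  have hac : e a c = 1 := by simp [he, hx]
  have hle : ∀ a c, e a c ≤ 1 := fun a c => by
    simp only [he]
    split_ifs <;> omega
  clear_value e
  clear hx he
  revert a c
  simp only [hr, hc, forall_zmod_three] at h1 h2 h3 h4 hle ⊢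
  refine ⟨⟨?_, ?_, ?_⟩, ⟨?_, ?_, ?_⟩, ?_, ?_, ?_⟩ <;> intro h <;> omega

theorem CycWin.rowCount_cast_ne (hm : 2 ≤ m) (hG : CycWin (m + 3) G) (v : ℕ) (a c : ZMod 3) :
    (rowCount G (v + 1) a (G (v + 1) a c) : ZMod 3) ≠ rowCount G (v + 2) (G (v + 1) a c) c := by
  have hlt : ∀ v a y, rowCount G (v + 1) a y < 3 := fun v a y => by
    have := hG.balance (by omega) v a y
    omega
  intro h
  have h := congrArg ZMod.val h
  rw [ZMod.val_natCast, ZMod.val_natCast, Nat.mod_eq_of_lt (hlt _ _ _),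
    Nat.mod_eq_of_lt (hlt _ _ _)] at h
  exact hG.rowCount_ne hm v a c h

/-- The slope of `rowCount G v` in its second argument. -/
def slope (G : ℕ → ZMod 3 → ZMod 3 → ZMod 3) (v : ℕ) : ZMod 3 :=
  rowCount G v 0 1 - rowCount G v 0 0

theorem CycWin.rowCount_eq (hm : 2 ≤ m) (hG : CycWin (m + 3) G) (v : ℕ) (x b : ZMod 3) :
    (rowCount G (v + 2) x b : ZMod 3) =
      -slope G (v + 1) * x + slope G (v + 2) * b + rowCount G (v + 2) 0 0 := by
  obtain ⟨hr, hc⟩ := hG.rowCount_latin hm v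
  obtain ⟨hr', hc'⟩ := hG.rowCount_latin hm (v + 1)
  have hsq : ∀ s t : ZMod 3, s * s = 1 → t * t = 1 → t ≠ s → t = -s := by decide
  have key : (rowCount G (v + 2) 1 0 - rowCount G (v + 2) 0 0 : ZMod 3) = -slope G (v + 1) := by
    refine hsq _ _ (ZMod.three_affine (hr 0) 0).2 (ZMod.three_affine (hc' 0) 0).2 fun hts => ?_
    have hp := (ZMod.three_affine (hc 0) 0).2
    set p : ZMod 3 := rowCount G (v + 1) 1 0 - rowCount G (v + 1) 0 0
    set a : ZMod 3 := p * (rowCount G (v + 2) 0 0 - rowCount G (v + 1) 0 0)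
    have heq : ∀ x, (rowCount G (v + 1) a x : ZMod 3) = rowCount G (v + 2) x 0 := by
      intro x
      rw [ZMod.three_latin hr hc a x, ZMod.three_latin hr' hc' x 0, hts]
      change p * (p * _) + slope G (v + 1) * x + _ = _
      rw [← mul_assoc, hp]
      ring
    exact hG.rowCount_cast_ne hm v a 0 (heq _)
  rw [ZMod.three_latin hr' hc' x b, key]
  rfl

theorem not_cycWin (hm : 2 ≤ m) (h3 : ¬ 3 ∣ m + 3) : ¬ CycWin (m + 3) G := by
  intro hG
  have hper : ∀ i, rowCount G (i + (m + 3)) = rowCount G i := fun i => by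
    funext a y
    rw [rowCount, hG.1, rowCount]
  have hslope : ∀ i, slope G (i + (m + 3)) = slope G i := fun i => by rw [slope, hper, slope]
  have hsq : ∀ v, slope G (v + 1) * slope G (v + 1) = 1 := fun v =>
    (ZMod.three_affine ((hG.rowCount_latin hm v).1 0) 0).2
  let γ (j : ℕ) : ZMod 3 := rowCount G (j + 2) 0 0
  have hγ : ∀ j, γ (j + (m + 3)) = γ j := fun j => by
    simp only [γ]
    rw [Nat.add_right_comm, hper]
  let k : ZMod 3 := (m + 3 : ℕ) * ∑ j ∈ Finset.range (m + 3), γ j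
  let u (i : ℕ) : ZMod 3 := ∑ j ∈ Finset.range i, (k - γ j)
  have hu : ∀ i, u (i + 1) = u i + (k - γ i) := fun i => Finset.sum_range_succ _ _
  have hun : u (m + 3) = 0 := by
    have hn : ((m + 3 : ℕ) : ZMod 3) ≠ 0 := by rwa [ne_eq, ZMod.natCast_eq_zero_iff]
    have hnn : ∀ s : ZMod 3, s ≠ 0 → s * s = 1 := by decide
    simp only [u, Finset.sum_sub_distrib, Finset.sum_const, Finset.card_range, nsmul_eq_mul, k]
    rw [← mul_assoc, hnn _ hn, one_mul, sub_self]
  have huper : ∀ i, u (i + (m + 3)) = u i := by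
    intro i
    induction i with
    | zero => rw [zero_add, hun]; rfl
    | succ i ih => rw [Nat.add_right_comm, hu, ih, hγ, hu]
  obtain ⟨i, hi⟩ := (hG.shift (by omega) 1).2 (fun i => slope G (i + 1) * u i) fun i => by
    rw [Nat.add_right_comm, hslope, huper]
  have hconst : ∀ i, (rowCount G (i + 2) (slope G (i + 1) * u i)
      (slope G (i + 2) * u (i + 1)) : ZMod 3) = k := by
    intro i
    rw [hG.rowCount_eq hm, hu]
    linear_combination -u i * hsq i + (u i + (k - γ i)) * hsq (i + 1)
  refine hG.rowCount_cast_ne hm (i + 1) (slope G (i + 1) * u i) (slope G (i + 3) * u (i + 2)) ?_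
  beta_reduce at hi
  rw [hi]
  exact (hconst i).trans (hconst (i + 1)).symm

theorem not_seqWin_three {F : ℕ → ℕ → ℕ → ℕ} (hm : 2 ≤ m) (h3 : ¬ 3 ∣ m + 3)
    (hF : ∀ i, F (i + (m + 3)) = F i) : ¬ SeqWin (m + 3) (fun _ => 3) F :=
  fun hw => not_cycWin hm h3 (cycWin_of_seqWin hF hw)

end Balanced

section Tour

variable {n : ℕ} {π : ℕ → Fin n} {h : Fin n → ℕ}

theorem IsTour.shift (hn : 3 ≤ n) (hπ : IsTour n π) (s : ℕ) : IsTour n fun i => π (i + s) where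
  periodic i := by rw [Nat.add_right_comm, hπ.periodic]
  surj v := by
    obtain ⟨j, rfl⟩ := hπ.surj v
    have hs : (n - 1) * s + s = n * s := by
      rw [← Nat.succ_mul, Nat.succ_eq_add_one, Nat.sub_add_cancel (by omega)]
    refine ⟨j + (n - 1) * s, eq_of_mod_eq hπ.periodic ?_⟩
    rw [add_assoc, hs, Nat.add_mul_mod_self_left]
  mod_eq i j hij := Nat.ModEq.add_right_cancel' s (hπ.mod_eq _ _ hij)
  adj i v := by
    rw [Nat.add_right_comm i 1 s, Nat.add_right_comm i 2 s]
    exact hπ.adj (i + s) v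

theorem IsTour.adj_succ (hπ : IsTour n π) (i : ℕ) :
    (SimpleGraph.cycleGraph n).Adj (π i) (π (i + 1)) :=
  ((hπ.adj i _).2 (Or.inl rfl)).symm

theorem IsTour.ne_of_lt (hπ : IsTour n π) {i j : ℕ} (hij : i < j) (hj : j < i + n) :
    π i ≠ π j := by
  intro he
  have h1 := (Nat.modEq_iff_dvd' hij.le).1 (hπ.mod_eq _ _ he)
  have h2 := Nat.le_of_dvd (by omega) h1
  omega

theorem exists_tour [NeZero n] (hn : 3 ≤ n) {x y : Fin n}
    (hxy : (SimpleGraph.cycleGraph n).Adj x y) : ∃ π, IsTour n π ∧ π 0 = x ∧ π 1 = y := by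
  rcases (cycleGraph_adj_iff hn x y).1 hxy with rfl | rfl
  · exact ⟨_, isTour_sub hn x, sub_zero x, rfl⟩
  · exact ⟨_, isTour_add hn x, add_zero x, rfl⟩

theorem exists_tour_one_two [NeZero n] (hn : 3 ≤ n) {x y : Fin n}
    (hxy : (SimpleGraph.cycleGraph n).Adj x y) : ∃ π, IsTour n π ∧ π 1 = x ∧ π 2 = y := by
  obtain ⟨π, hπ, h0, h1⟩ := exists_tour hn hxy
  refine ⟨_, hπ.shift hn (n - 1), ?_, ?_⟩
  · rw [show 1 + (n - 1) = 0 + n by omega, hπ.periodic, h0]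
  · rw [show 2 + (n - 1) = 1 + n by omega, hπ.periodic, h1]

theorem exists_tour_apply_eq [NeZero n] (hn : 3 ≤ n) (v : Fin n) {k : ℕ} (hk : k ≤ n) :
    ∃ π, IsTour n π ∧ π k = v := by
  refine ⟨_, (isTour_add hn v).shift hn (n - k), ?_⟩
  have : k + (n - k) = n := by omega
  ext
  simp [this]

theorem IsTour.exists_five_le (hn : 3 ≤ n) (hpos : ∀ v, 0 < h v) (hπ : IsTour n π)
    (hno : ¬ ∃ G' : (SimpleGraph.cycleGraph n).Subgraph, G' ≠ ⊤ ∧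
      Winning G'.coe (fun v => h v.val))
    {p r : ℕ} (hpr : p < r) (hr : r < p + n) (hp2 : h (π p) = 2) (hr2 : h (π r) = 2) :
    ∃ j, p < j ∧ j < r ∧ 5 ≤ h (π j) := by
  by_contra! hcon
  refine hno (exists_winning_subgraph hn hpos (hπ.shift hn p) (l := r - p) (by omega) (by omega)
    (by rwa [zero_add]) (by rwa [Nat.sub_add_cancel hpr.le]) fun j hj hjl => ?_)
  have := hcon (j + p) (by omega) (by omega)
  omega

end Tour

section Cycle

variable {m : ℕ} {h : Fin (m + 3) → ℕ}

theorem not_winning_of_two_of_five (hm : 1 ≤ m) (hh : ∀ v, 2 ≤ h v)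
    (hno : ¬ ∃ G' : (SimpleGraph.cycleGraph (m + 3)).Subgraph, G' ≠ ⊤ ∧
      Winning G'.coe (fun v => h v.val))
    {v w : Fin (m + 3)} (hv : h v = 2) (hw : 5 ≤ h w) :
    ¬ Winning (SimpleGraph.cycleGraph (m + 3)) h := by
  intro hwin
  have hn : 3 ≤ m + 3 := by omega
  have hpos : ∀ v, 0 < h v := fun v => by have := hh v; omega
  have key : ∀ π, IsTour (m + 3) π → h (π 2) = 2 →
      ¬ (h (π 1) < 5 ∨ ∀ i, h (π i) = 2 → 5 ≤ h (π (i + 1)) ∧ 5 ≤ h (π (i + (m + 2)))) := by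
    intro π hπ h2 hnbr
    obtain ⟨F, hF, hFw⟩ := seqWin_of_winning hn hpos hπ hwin
    obtain ⟨j, rfl⟩ := hπ.surj w
    exact not_seqWin_mixed (H := fun i => h (π i)) (fun i => hh _)
      (fun p r hpr hr hp2 hr2 => hπ.exists_five_le hn hpos hno hpr hr hp2 hr2) hm hF
      (fun i => by rw [hπ.periodic]) h2 ⟨j, hw⟩ hnbr hFw
  by_cases hx : ∃ u v, (SimpleGraph.cycleGraph (m + 3)).Adj u v ∧ h v = 2 ∧ h u < 5
  · obtain ⟨u, v, huv, hv, hu⟩ := hx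
    obtain ⟨π, hπ, h1, h2⟩ := exists_tour_one_two hn huv
    exact key π hπ (by rw [h2, hv]) (Or.inl (by rwa [h1]))
  · push Not at hx
    obtain ⟨π, hπ, h2⟩ := exists_tour_apply_eq hn v (k := 2) (by omega)
    refine key π hπ (by rw [h2, hv]) (Or.inr fun i hi => ⟨hx _ _ (hπ.adj_succ i).symm hi, ?_⟩)
    refine hx _ (π (i + (m + 3))) (hπ.adj_succ (i + (m + 2))) ?_
    rw [hπ.periodic, hi]

theorem not_winning_of_unique_two (hm : 1 ≤ m) (hh : ∀ v, 2 ≤ h v)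
    (hpat : ¬ ∃ x y z : Fin (m + 3), (SimpleGraph.cycleGraph (m + 3)).Adj x y ∧
      (SimpleGraph.cycleGraph (m + 3)).Adj y z ∧ x ≠ z ∧
      ((h x = 2 ∧ h y = 3 ∧ h z = 3) ∨ (h x = 3 ∧ h y = 2 ∧ h z = 3)))
    {v : Fin (m + 3)} (hv : h v = 2) (huniq : ∀ u, h u = 2 → u = v) :
    ¬ Winning (SimpleGraph.cycleGraph (m + 3)) h := by
  intro hwin
  have hn : 3 ≤ m + 3 := by omega
  have hpos : ∀ v, 0 < h v := fun v => by have := hh v; omega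
  have h3 : ∀ u, u ≠ v → 3 ≤ h u := fun u hu => by
    have h1 := hh u
    have h2 := mt (huniq u) hu
    omega
  have key : ∀ π, IsTour (m + 3) π → π 2 = v → ¬ 4 ≤ h (π 3) := by
    intro π hπ h2 h4
    obtain ⟨F, hF, hFw⟩ := seqWin_of_winning hn hpos hπ hwin
    have hlt : ∀ i, i < 2 → 3 ≤ h (π i) := fun i hi =>
      h3 _ (by rw [← h2]; exact hπ.ne_of_lt hi (by omega))
    have hgt : ∀ i, 3 ≤ i → i ≤ m + 2 → 3 ≤ h (π i) := fun i hi hi' =>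
      h3 _ (by rw [← h2]; exact (hπ.ne_of_lt hi (by omega)).symm)
    have e0 := hlt 0 (by omega)
    have e1 := hlt 1 (by omega)
    have main := fun q r => not_seqWin_single_two (H := fun i => h (π i)) (q := q) (r := r) hm hF
      (fun i => by rw [hπ.periodic]) (by rw [h2, hv]) h4 hgt
    by_cases h1 : 4 ≤ h (π 1)
    · exact main 3 4 e0 h1 le_rfl (by norm_num) hFw
    · refine main 4 3 ?_ e1 (by norm_num) (by norm_num) hFw
      by_contra h0
      refine hpat ⟨π 2, π 1, π 0, (hπ.adj_succ 1).symm, (hπ.adj_succ 0).symm,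
        (hπ.ne_of_lt (by omega) (by omega)).symm, Or.inl ⟨by rw [h2, hv], ?_, ?_⟩⟩ <;>
      beta_reduce at * <;> omega
  obtain ⟨π, hπ, h2⟩ := exists_tour_apply_eq hn v (k := 2) (by omega)
  have hne : π 1 ≠ π 3 := hπ.ne_of_lt (by omega) (by omega)
  obtain ⟨ρ, hρ, r1, r2⟩ := exists_tour_one_two hn (hπ.adj_succ 2).symm
  have r3 : ρ 3 = π 1 := by
    rcases (hρ.adj 1 (π 1)).1 (by rw [r2]; exact (hπ.adj_succ 1).symm) with he | he
    · exact absurd (he.trans r1) hne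
    · exact he.symm
  have k1 := key π hπ h2
  have k2 := key ρ hρ (r2.trans h2)
  rw [r3] at k2
  have e1 := h3 (π 1) (by rw [← h2]; exact hπ.ne_of_lt (by omega) (by omega))
  have e3 := h3 (π 3) (by rw [← h2]; exact (hπ.ne_of_lt (by omega) (by omega)).symm)
  exact hpat ⟨π 1, π 2, π 3, hπ.adj_succ 1, hπ.adj_succ 2, hne,
    Or.inr ⟨by omega, by rw [h2, hv], by omega⟩⟩

theorem not_winning_of_three_le (hm : 1 ≤ m) (h3 : ∀ v, 3 ≤ h v)
    (hn3 : ¬ ((m + 3 = 4 ∨ 3 ∣ m + 3) ∧ ∀ v, h v ≤ 3)) :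
    ¬ Winning (SimpleGraph.cycleGraph (m + 3)) h := by
  intro hwin
  have hn : 3 ≤ m + 3 := by omega
  have hpos : ∀ v, 0 < h v := fun v => by have := h3 v; omega
  by_cases h4 : ∃ v, 4 ≤ h v
  · obtain ⟨v, hv⟩ := h4
    obtain ⟨π, hπ, h0⟩ := exists_tour_apply_eq hn v (k := 0) (by omega)
    obtain ⟨F, hF, hFw⟩ := seqWin_of_winning hn hpos hπ hwin
    exact not_seqWin_of_four_le hm hF (fun i => by rw [hπ.periodic]) (fun i => h3 _)
      (by rwa [h0]) hFw
  · have hle : ∀ v, h v ≤ 3 := fun v => by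
      by_contra! hv
      exact h4 ⟨v, hv⟩
    obtain rfl : h = fun _ => 3 := funext fun v => le_antisymm (hle v) (h3 v)
    obtain ⟨F, hF, hFw⟩ := seqWin_of_winning hn hpos (isTour_add hn 0) hwin
    have hn4 : ¬ (m + 3 = 4 ∨ 3 ∣ m + 3) := fun h => hn3 ⟨h, hle⟩
    exact not_seqWin_three (by omega) (fun h => hn4 (Or.inr h)) hF hFw

theorem winning_of_pattern {n : ℕ} [NeZero n] (hn : 3 ≤ n) {h : Fin n → ℕ} (hh : ∀ v, 2 ≤ h v)
    {x y z : Fin n} (hxy : (SimpleGraph.cycleGraph n).Adj x y)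
    (hyz : (SimpleGraph.cycleGraph n).Adj y z) (hxz : x ≠ z)
    (hpat : (h x = 2 ∧ h y = 3 ∧ h z = 3) ∨ (h x = 3 ∧ h y = 2 ∧ h z = 3)) (h4 : ∀ v, h v ≤ 4) :
    Winning (SimpleGraph.cycleGraph n) h := by
  have hpos : ∀ v, 0 < h v := fun v => by have := hh v; omega
  rcases hn.eq_or_lt with rfl | hn4
  · refine winning_triangle hpos ?_
    have huniv : (Finset.univ : Finset (Fin 3)) = {x, y, z} := by
      refine (Finset.eq_univ_of_card _ ?_).symm
      rw [Finset.card_eq_three.2 ⟨x, y, z, hxy.ne, hxz, hyz.ne, rfl⟩, Fintype.card_fin]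
    rw [huniv, Finset.sum_insert (by simp [hxy.ne, hxz]), Finset.sum_insert (by simp [hyz.ne]),
      Finset.sum_singleton]
    rcases hpat with ⟨e1, e2, e3⟩ | ⟨e1, e2, e3⟩ <;> rw [e1, e2, e3] <;> norm_num
  · obtain ⟨π, hπ, h0, h1⟩ := exists_tour hn hxy
    have h2 : π 2 = z := by
      rcases (hπ.adj 0 z).1 (by rwa [zero_add, h1]) with he | he
      · exact absurd (h0.symm.trans he.symm) hxz
      · exact he.symm
    obtain ⟨F, hF, hw⟩ : ∃ F : ℕ → ℕ → ℕ → ℕ, (∀ i, F (i + n) = F i) ∧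
        SeqWin n (fun i => h (π i)) F := by
      rw [← h0, ← h1, ← h2] at hpat
      rcases hpat with ⟨e1, e2, e3⟩ | ⟨e1, e2, e3⟩
      · exact exists_seqWin_two_three_three hn4 (fun i => h4 _) e1 e2 e3
      · exact exists_seqWin_three_two_three hn4 (fun i => h4 _) e1 e2 e3
    exact winning_of_seqWin hpos hπ hF hw

theorem winning_of_le_three {n : ℕ} [NeZero n] (hn : 3 ≤ n) {h : Fin n → ℕ} (hh : ∀ v, 2 ≤ h v)
    (hn3 : n = 4 ∨ 3 ∣ n) (h3 : ∀ v, h v ≤ 3) : Winning (SimpleGraph.cycleGraph n) h := by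
  have hpos : ∀ v, 0 < h v := fun v => by have := hh v; omega
  obtain ⟨F, hF, hw⟩ : ∃ F : ℕ → ℕ → ℕ → ℕ, (∀ i, F (i + n) = F i) ∧
      SeqWin n (fun i => h (0 + Fin.ofNat n i)) F := by
    rcases hn3 with rfl | hd
    · exact exists_seqWin_four fun i => h3 _
    · exact exists_seqWin_of_three_dvd (by omega) hd fun i => h3 _
  exact winning_of_seqWin hpos (isTour_add hn 0) hF hw

end Cycle

end HatGame

/-- Theorem 1 (cycles): for a cycle `C` on `n ≥ 3` vertices with all hatnesses at
least `2`, the game `⟨C, h⟩` is winning iff one of the four listed conditions holds. -/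
theorem cycle_winning_iff (n : ℕ) [NeZero n] (hn : 3 ≤ n) (h : Fin n → ℕ)
    (hh : ∀ v, 2 ≤ h v) :
    HatGame.Winning (SimpleGraph.cycleGraph n) h ↔
      -- (1) the length is 4 or divisible by 3 and all hatnesses are at most 3
      (((n = 4 ∨ 3 ∣ n) ∧ ∀ v, h v ≤ 3) ∨
      -- (2) the length is 3 and the reciprocals of the hatnesses sum to at least 1
      (n = 3 ∧ 1 ≤ ∑ v : Fin n, ((h v : ℚ))⁻¹) ∨
      -- (3) the game contains a winning proper subgame
      (∃ G' : (SimpleGraph.cycleGraph n).Subgraph, G' ≠ ⊤ ∧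
        HatGame.Winning G'.coe (fun v => h v.val)) ∨
      -- (4) there are three consecutive vertices with hatnesses (2,3,3) or (3,2,3),
      --     and all hatnesses are at most 4
      ((∃ x y z : Fin n, (SimpleGraph.cycleGraph n).Adj x y ∧
          (SimpleGraph.cycleGraph n).Adj y z ∧ x ≠ z ∧
          ((h x = 2 ∧ h y = 3 ∧ h z = 3) ∨ (h x = 3 ∧ h y = 2 ∧ h z = 3))) ∧
        (∀ v, h v ≤ 4))) := by
  have hpos : ∀ v, 0 < h v := fun v => by have := hh v; omega
  constructor
  · intro hwin
    obtain ⟨m, rfl⟩ : ∃ m, n = m + 3 := ⟨n - 3, by omega⟩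
    rcases Nat.eq_zero_or_pos m with rfl | hm
    · exact Or.inr (Or.inl ⟨rfl, HatGame.one_le_sum_inv_of_winning hpos hwin⟩)
    by_contra! hcon
    obtain ⟨hn3, -, hno, hpat⟩ := hcon
    replace hno : ¬ ∃ G' : (SimpleGraph.cycleGraph (m + 3)).Subgraph, G' ≠ ⊤ ∧
        HatGame.Winning G'.coe (fun v => h v.val) := fun ⟨G', h1, h2⟩ => hno G' h1 h2
    by_cases htwo : ∃ v, h v = 2
    · obtain ⟨v, hv⟩ := htwo
      have h4 : ∀ w, h w ≤ 4 := fun w => by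
        by_contra! hw
        exact HatGame.not_winning_of_two_of_five hm hh hno hv hw hwin
      refine HatGame.not_winning_of_unique_two hm hh (fun hp => ?_) hv (fun u hu => ?_) hwin
      · obtain ⟨w, hw⟩ := hpat hp
        exact hw.not_ge (h4 w)
      · obtain ⟨π, hπ, h0⟩ := HatGame.exists_tour_apply_eq hn v (k := 0) (by omega)
        by_contra hne
        obtain ⟨i, rfl⟩ := hπ.surj u
        have hi : π (i % (m + 3)) = π i := Function.Periodic.map_mod_nat hπ.periodic i
        rw [← hi] at hu hne
        have hlt : i % (m + 3) < m + 3 := Nat.mod_lt _ (by omega)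
        have hi0 : 0 < i % (m + 3) := Nat.pos_of_ne_zero fun h' => hne (by rw [h', h0])
        obtain ⟨j, -, -, hj⟩ := hπ.exists_five_le hn hpos hno hi0 (by omega) (by rw [h0, hv]) hu
        exact (Nat.lt_of_lt_of_le (by norm_num) hj).not_ge (h4 (π j))
    · refine HatGame.not_winning_of_three_le hm (fun v => ?_) (fun ⟨h1, h2⟩ => ?_) hwin
      · have h1 := hh v
        have h2 : h v ≠ 2 := fun h' => htwo ⟨v, h'⟩
        omega
      · obtain ⟨w, hw⟩ := hn3 h1
        exact hw.not_ge (h2 w)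
  · rintro (⟨hn3, h3⟩ | ⟨rfl, hsum⟩ | ⟨G', -, hw⟩ | ⟨⟨x, y, z, hxy, hyz, hxz, hpat⟩, h4⟩)
    · exact HatGame.winning_of_le_three hn hh hn3 h3
    · exact HatGame.winning_triangle hpos hsum
    · exact HatGame.Winning.of_subgraph hpos G' hw
    · exact HatGame.winning_of_pattern hn hh hxy hyz hxz hpat h4
end

section
/- Let G be a cactus graph. Then HG(G) = 4 if and only if G contains at least two triangles (cycles of length 3). -/
/-- `G` contains at least two (distinct) triangles, i.e. two cycles of length 3
with different edge sets. -/
def SimpleGraph.HasTwoTriangles {V : Type*} (G : SimpleGraph V) : Prop :=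
  ∃ (v w : V) (c₁ : G.Walk v v) (c₂ : G.Walk w w),
    c₁.IsCycle ∧ c₂.IsCycle ∧ c₁.length = 3 ∧ c₂.length = 3 ∧
    {e | e ∈ c₁.edges} ≠ {e | e ∈ c₂.edges}

/-- `G` contains at least two (distinct) cycles, i.e. two cycles with different
edge sets. -/
def SimpleGraph.HasTwoCycles {V : Type*} (G : SimpleGraph V) : Prop :=
  ∃ (v w : V) (c₁ : G.Walk v v) (c₂ : G.Walk w w),
    c₁.IsCycle ∧ c₂.IsCycle ∧ {e | e ∈ c₁.edges} ≠ {e | e ∈ c₂.edges}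

/-- `G` contains a cycle whose length is 4 or divisible by 3. -/
def SimpleGraph.HasGoodCycle {V : Type*} (G : SimpleGraph V) : Prop :=
  ∃ (v : V) (c : G.Walk v v), c.IsCycle ∧ (c.length = 4 ∨ 3 ∣ c.length)

theorem exists_common_mem {α β : Type*} [DecidableEq β] {T : Finset α} {U : Finset β}
    {R : α → Finset β} {m : ℕ} (hR : ∀ y ∈ T, R y ⊆ U) (hm : ∀ y ∈ T, m ≤ (R y).card)
    (h : U.card < T.card * m) :
    ∃ y ∈ T, ∃ y' ∈ T, y ≠ y' ∧ ∃ z, z ∈ R y ∧ z ∈ R y' := by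
  by_contra! hc
  have hd : (T : Set α).PairwiseDisjoint R := by
    intro y hy y' hy' hne
    exact Finset.disjoint_left.2 fun z hz hz' => hc y hy y' hy' hne z hz hz'
  have h1 : (T.biUnion R).card ≤ U.card := Finset.card_le_card (Finset.biUnion_subset.2 hR)
  rw [Finset.card_biUnion hd] at h1
  have h2 := Finset.card_nsmul_le_sum T (fun y => (R y).card) m hm
  simp only [smul_eq_mul] at h2
  lia

/-- The color `y` of the first of `N` consecutive path vertices extends to colors `k 1, …, k N`
which are all guessed wrong, when the colors before and after the path are `p` and `d` and the
last color is taken from `C`. -/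
def PathExtends {q : ℕ} (C : Finset (Fin q)) (d : Fin q) (g : ℕ → Fin q → Fin q → Fin q)
    (N : ℕ) (p y : Fin q) : Prop :=
  ∃ k : ℕ → Fin q, k 0 = p ∧ k 1 = y ∧ k N ∈ C ∧ k (N + 1) = d ∧
    ∀ i < N, g (i + 1) (k i) (k (i + 2)) ≠ k (i + 1)

theorem PathExtends.cons {q : ℕ} {C : Finset (Fin q)} {d : Fin q}
    {g : ℕ → Fin q → Fin q → Fin q} {N : ℕ} {p y z : Fin q}
    (h : PathExtends C d (fun i => g (i + 1)) N y z) (hy : g 1 p z ≠ y) :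
    PathExtends C d g (N + 1) p y := by
  obtain ⟨k, h0, h1, hC, hd, hk⟩ := h
  refine ⟨fun i => Nat.casesOn i p k, rfl, h0, hC, hd, fun i hi => ?_⟩
  rcases i with _ | i
  · simpa [h0, h1] using hy
  · exact hk i (by lia)

theorem exists_common_pathExtends {q t : ℕ} (hq : q < t * (q + 1 - t)) {C : Finset (Fin q)}
    (hC : C.card < t * (C.card - 1)) (d : Fin q) (N : ℕ) (hN : 1 ≤ N) :
    ∀ (g : ℕ → Fin q → Fin q → Fin q) (T : Finset (Fin q)), T.card = t →
      ∃ y ∈ T, ∃ y' ∈ T, y ≠ y' ∧ ∃ z, PathExtends C d g N y z ∧ PathExtends C d g N y' z := by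
  induction N, hN using Nat.le_induction with
  | base =>
    intro g T hT
    obtain ⟨y, hy, y', hy', hne, z, hz, hz'⟩ := exists_common_mem (T := T) (U := C)
      (R := fun y => C.erase (g 1 y d)) (m := C.card - 1) (fun y _ => Finset.erase_subset _ _)
      (fun y _ => Finset.pred_card_le_card_erase) (by rwa [hT])
    rw [Finset.mem_erase] at hz hz'
    have key : ∀ p, z ≠ g 1 p d → PathExtends C d g 1 p z := by
      intro p hp
      refine ⟨fun i => if i = 0 then p else if i = 1 then z else d, by simp, by simp,
        by simpa using hz.2, by simp, fun i hi => ?_⟩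
      obtain rfl : i = 0 := by lia
      simpa using hp.symm
    exact ⟨y, hy, y', hy', hne, z, key y hz.1, key y' hz'.1⟩
  | succ N hN ih =>
    intro g T hT
    classical
    have hS : ∀ (p : Fin q) (T : Finset (Fin q)), T.card = t →
        ∃ y ∈ T, PathExtends C d g (N + 1) p y := by
      intro p T hT
      obtain ⟨y, hy, y', hy', hne, z, hz, hz'⟩ := ih (fun i => g (i + 1)) T hT
      by_cases h : g 1 p z = y
      · exact ⟨y', hy', hz'.cons (by rwa [h])⟩
      · exact ⟨y, hy, hz.cons h⟩
    obtain ⟨y, hy, y', hy', hne, z, hz, hz'⟩ := exists_common_mem (T := T) (U := Finset.univ)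
      (R := fun y => Finset.univ.filter fun z => PathExtends C d g (N + 1) y z)
      (m := q + 1 - t) (fun y _ => Finset.subset_univ _) (fun p _ => by
        by_contra! hlt
        have h1 := Finset.card_filter_add_card_filter_not (s := (Finset.univ : Finset (Fin q)))
          (fun z => PathExtends C d g (N + 1) p z)
        rw [Finset.card_univ, Fintype.card_fin] at h1
        obtain ⟨T', hT', hc⟩ := Finset.exists_subset_card_eq
          (s := Finset.univ.filter fun z => ¬ PathExtends C d g (N + 1) p z) (n := t) (by lia)
        obtain ⟨y, hy, hyp⟩ := hS p T' hc
        exact (Finset.mem_filter.1 (hT' hy)).2 hyp) (by simpa [hT] using hq)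
    exact ⟨y, hy, y', hy', hne, z, (Finset.mem_filter.1 hz).2, (Finset.mem_filter.1 hz').2⟩

theorem exists_pathExtends {q t : ℕ} (hq : q < t * (q + 1 - t)) {B C : Finset (Fin q)}
    (hB : t ≤ B.card) (hC : C.card < t * (C.card - 1)) (d : Fin q) {N : ℕ} (hN : 2 ≤ N)
    (g : ℕ → Fin q → Fin q → Fin q) (p : Fin q) : ∃ y ∈ B, PathExtends C d g N p y := by
  obtain ⟨T, hT, hTc⟩ := Finset.exists_subset_card_eq hB
  obtain ⟨N, rfl⟩ : ∃ M, N = M + 1 := ⟨N - 1, by lia⟩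
  obtain ⟨y, hy, y', hy', hne, z, hz, hz'⟩ :=
    exists_common_pathExtends hq hC d N (by lia) (fun i => g (i + 1)) T hTc
  by_cases h : g 1 p z = y
  · exact ⟨y', hT hy', hz'.cons (by rwa [h])⟩
  · exact ⟨y, hT hy, hz.cons h⟩

/-- The set of arguments at which `f` takes the value `a`. -/
def fiber {q : ℕ} (f : Fin q → Fin q) (a : Fin q) : Finset (Fin q) :=
  Finset.univ.filter fun y => f y = a

theorem mem_fiber {q : ℕ} {f : Fin q → Fin q} {a y : Fin q} : y ∈ fiber f a ↔ f y = a := by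
  simp [fiber]

theorem sum_card_fiber {q : ℕ} (f : Fin q → Fin q) : ∑ a, (fiber f a).card = q := by
  have := Finset.card_eq_sum_card_fiberwise (s := (Finset.univ : Finset (Fin q)))
    (t := Finset.univ) (f := f) (by simp)
  simpa [fiber] using this.symm

theorem small_fibers_or {q : ℕ} (f f' : Fin q → Fin q) :
    (∃ a, (fiber f a).card ≤ 1 ∧ (fiber f' a).card ≤ 1) ∨
      ∀ a, ((fiber f a).card = 2 ∧ (fiber f' a).card = 0) ∨
        ((fiber f a).card = 0 ∧ (fiber f' a).card = 2) := by
  by_contra! h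
  obtain ⟨h1, b, hb⟩ := h
  have hle : ∀ a, 2 ≤ (fiber f a).card + (fiber f' a).card := by
    intro a
    have := h1 a
    lia
  have hsum : ∑ a, ((fiber f a).card + (fiber f' a).card) = q * 2 := by
    rw [Finset.sum_add_distrib, sum_card_fiber, sum_card_fiber]; ring
  have hlt : ∑ _a : Fin q, 2 < ∑ a, ((fiber f a).card + (fiber f' a).card) := by
    refine Finset.sum_lt_sum (fun a _ => hle a) ⟨b, Finset.mem_univ _, ?_⟩
    have := hle b
    have := h1 b
    lia
  simp [hsum] at hlt

theorem card_fiber_pos {q : ℕ} (f : Fin q → Fin q) (y : Fin q) : 0 < (fiber f (f y)).card :=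
  Finset.card_pos.2 ⟨y, mem_fiber.2 rfl⟩

/-- Two values can be picked so that, for both pairs of functions, only few arguments
are mapped to them. -/
theorem exists_small_fibers {q : ℕ} (hq : 0 < q) (f f' g g' : Fin q → Fin q) :
    ∃ a d, ((fiber f a).card + (fiber g d).card ≤ 3 ∧ (fiber f a ∪ fiber g d).card ≤ 2) ∧
      ((fiber f' a).card + (fiber g' d).card ≤ 3 ∧ (fiber f' a ∪ fiber g' d).card ≤ 2) := by
  have hu := fun a d => Finset.card_union_le (fiber f a) (fiber g d)
  have hu' := fun a d => Finset.card_union_le (fiber f' a) (fiber g' d)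
  have mixed : ∀ (f f' g g' : Fin q → Fin q) (a : Fin q), (fiber f a).card ≤ 1 →
      (fiber f' a).card ≤ 1 → (∀ d, ((fiber g d).card = 2 ∧ (fiber g' d).card = 0) ∨
        ((fiber g d).card = 0 ∧ (fiber g' d).card = 2)) →
      ∃ d, ((fiber f a).card + (fiber g d).card ≤ 3 ∧ (fiber f a ∪ fiber g d).card ≤ 2) ∧
      ((fiber f' a).card + (fiber g' d).card ≤ 3 ∧ (fiber f' a ∪ fiber g' d).card ≤ 2) := by
    intro f f' g g' a ha ha' hg
    have hsub : ∃ p, fiber f a ⊆ fiber g (g p) := by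
      rcases (fiber f a).eq_empty_or_nonempty with he | ⟨p, hp⟩
      · exact ⟨⟨0, hq⟩, by simp [he]⟩
      · refine ⟨p, fun z hz => ?_⟩
        rw [Finset.card_le_one.1 ha z hz p hp, mem_fiber]
    obtain ⟨p, hp⟩ := hsub
    have h0 := card_fiber_pos g p
    have h1 := hg (g p)
    have h2 := Finset.card_union_le (fiber f' a) (fiber g' (g p))
    refine ⟨g p, ⟨by lia, ?_⟩, by lia, by lia⟩
    rw [Finset.union_eq_right.2 hp]
    lia
  rcases small_fibers_or f f' with ⟨a, ha, ha'⟩ | hf <;>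
    rcases small_fibers_or g g' with ⟨d, hd, hd'⟩ | hg
  · have := hu a d
    have := hu' a d
    exact ⟨a, d, by lia, by lia⟩
  · exact ⟨a, mixed f f' g g' a ha ha' hg⟩
  · obtain ⟨a, h⟩ := mixed g g' f f' d hd hd' hf
    exact ⟨a, d, by simpa only [add_comm, Finset.union_comm] using h⟩
  · have h1 := hf (f ⟨0, hq⟩)
    have h2 := card_fiber_pos f ⟨0, hq⟩
    have h3 := hg (g' ⟨0, hq⟩)
    have h4 := card_fiber_pos g' ⟨0, hq⟩
    have := hu (f ⟨0, hq⟩) (g' ⟨0, hq⟩)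
    have := hu' (f ⟨0, hq⟩) (g' ⟨0, hq⟩)
    exact ⟨f ⟨0, hq⟩, g' ⟨0, hq⟩, by lia, by lia⟩

/-- On a cycle with `n` vertices, numbered `1, …, n` with `0` another name of `n`, the guessing
functions `g` are defeated by some coloring `k` with `k 0 ∈ X`. -/
def CycleLosing (n q : ℕ) (X : Finset (Fin q)) : Prop :=
  ∀ g : ℕ → Fin q → Fin q → Fin q, ∃ k : ℕ → Fin q, k 0 ∈ X ∧ k n = k 0 ∧ k (n + 1) = k 1 ∧
    ∀ i < n, g (i + 1) (k i) (k (i + 2)) ≠ k (i + 1)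

theorem exists_path_between {q : ℕ} (hq : 4 ≤ q) (g : ℕ → Fin q → Fin q → Fin q) {N : ℕ}
    (hN : 1 ≤ N) (u v : Fin q → Fin q) {a d : Fin q}
    (h : (fiber u a).card + (fiber v d).card ≤ 3) (h' : (fiber u a ∪ fiber v d).card ≤ 2) :
    ∃ k : ℕ → Fin q, k 0 = a ∧ u (k 1) ≠ a ∧ v (k N) ≠ d ∧ k (N + 1) = d ∧
      ∀ i < N, g (i + 1) (k i) (k (i + 2)) ≠ k (i + 1) := by
  rcases hN.eq_or_lt with rfl | hN
  · obtain ⟨y, hy⟩ : ∃ y, y ∉ insert (g 1 a d) (fiber u a ∪ fiber v d) := by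
      by_contra! hc
      have h1 := Finset.card_le_card (fun y _ => hc y : Finset.univ ⊆ _)
      have h2 := Finset.card_insert_le (g 1 a d) (fiber u a ∪ fiber v d)
      simp only [Finset.card_univ, Fintype.card_fin] at h1
      lia
    simp only [Finset.mem_insert, Finset.mem_union, mem_fiber, not_or] at hy
    refine ⟨fun i => if i = 0 then a else if i = 1 then y else d, by simp, by simpa using hy.2.1,
      by simpa using hy.2.2, by simp, fun i hi => ?_⟩
    obtain rfl : i = 0 := by lia
    simpa using Ne.symm hy.1
  · have hu : (fiber u a).card ≤ 2 := (Finset.card_le_card Finset.subset_union_left).trans h'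
    have hv : (fiber v d).card ≤ 2 := (Finset.card_le_card Finset.subset_union_right).trans h'
    have hcu := Finset.card_compl (fiber u a)
    have hcv := Finset.card_compl (fiber v d)
    rw [Fintype.card_fin] at hcu hcv
    have : ∃ y ∈ (fiber u a)ᶜ, PathExtends (fiber v d)ᶜ d g N a y := by
      by_cases h3 : 3 ≤ ((fiber v d)ᶜ).card
      · exact exists_pathExtends (t := 2) (by lia) (by lia) (by lia) d hN g a
      · exact exists_pathExtends (t := 3) (by lia) (by lia) (by lia) d hN g a
    obtain ⟨y, hy, k, h0, h1, hC, hd, hk⟩ := this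
    subst h1
    simp only [Finset.mem_compl, mem_fiber] at hy hC
    exact ⟨k, h0, hy, hC, hd, hk⟩

theorem cycleLosing_pair {q n : ℕ} (hq : 4 ≤ q) (hn : 4 ≤ n) {x x' : Fin q} (hx : x ≠ x') :
    CycleLosing n q {x, x'} := by
  intro g
  obtain ⟨N, rfl⟩ : ∃ N, n = N + 3 := ⟨n - 3, by lia⟩
  obtain ⟨a, d, had, had'⟩ := exists_small_fibers (by lia) (fun y => g 1 x y) (fun y => g 1 x' y)
    (fun y => g (N + 2) y x) (fun y => g (N + 2) y x')
  have key : ∃ X, (X = x ∨ X = x') ∧ g (N + 3) d a ≠ X ∧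
      ∃ k : ℕ → Fin q, k 0 = a ∧ g 1 X (k 1) ≠ a ∧ g (N + 2) (k N) X ≠ d ∧ k (N + 1) = d ∧
        ∀ i < N, g (i + 1 + 1) (k i) (k (i + 2)) ≠ k (i + 1) := by
    by_cases h : g (N + 3) d a = x
    · exact ⟨x', Or.inr rfl, by rwa [h], exists_path_between hq (fun i => g (i + 1)) (by lia)
        (fun y => g 1 x' y) (fun y => g (N + 2) y x') had'.1 had'.2⟩
    · exact ⟨x, Or.inl rfl, h, exists_path_between hq (fun i => g (i + 1)) (by lia)
        (fun y => g 1 x y) (fun y => g (N + 2) y x) had.1 had.2⟩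
  obtain ⟨X, hX, hgX, k, h0, h1, hN, hd, hk⟩ := key
  refine ⟨fun i => if i = 0 ∨ i = N + 3 then X else if i = N + 4 then a else k (i - 1),
    by simpa using hX, by simp, by simp [h0], fun i hi => ?_⟩
  rcases i with _ | i
  · have : (1 : ℕ) ≠ N + 3 ∧ 2 ≠ N + 3 ∧ 2 ≠ N + 4 ∧ (1 : ℕ) ≠ N + 4 := by lia
    simpa [this, h0] using h1
  · rcases lt_trichotomy i N with hi | rfl | hi
    · have : i + 1 ≠ N + 3 ∧ i + 1 ≠ N + 4 ∧ i + 2 ≠ N + 3 ∧ i + 2 ≠ N + 4 ∧ i ≠ N ∧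
        i ≠ N + 1 ∧ i ≠ N + 2 ∧ i ≠ N + 3 := by lia
      simpa [this] using hk i hi
    · simpa [hd] using hN
    · obtain rfl : i = N + 1 := by lia
      simpa [hd] using hgX

theorem cycleLosing_three {q : ℕ} {X : Finset (Fin q)}
    (hX : q * q + 2 * (X.card * q) < X.card * (q * q)) : CycleLosing 3 q X := by
  intro g
  classical
  let S : Finset (Fin q × Fin q × Fin q) := X ×ˢ Finset.univ ×ˢ Finset.univ
  let A := (X ×ˢ (Finset.univ : Finset (Fin q))).image fun r => (r.1, g 1 r.1 r.2, r.2)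
  let B := (X ×ˢ (Finset.univ : Finset (Fin q))).image fun r => (r.1, r.2, g 2 r.2 r.1)
  let C := (Finset.univ : Finset (Fin q × Fin q)).image fun r => (g 3 r.2 r.1, r.1, r.2)
  have hS : S.card = X.card * (q * q) := by simp [S, Finset.card_product]
  have hA : A.card ≤ X.card * q := Finset.card_image_le.trans (by simp [Finset.card_product])
  have hB : B.card ≤ X.card * q := Finset.card_image_le.trans (by simp [Finset.card_product])
  have hC : C.card ≤ q * q := Finset.card_image_le.trans (by simp)
  have h1 := Finset.card_union_le (A ∪ B) C
  have h2 := Finset.card_union_le A B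
  obtain ⟨⟨r, a, d⟩, hr, hn⟩ := Finset.exists_mem_notMem_of_card_lt_card
    (s := A ∪ B ∪ C) (t := S) (by lia)
  simp only [S, Finset.mem_product, Finset.mem_univ, and_true] at hr
  simp only [A, B, C, Finset.mem_union, Finset.mem_image, Finset.mem_product, Finset.mem_univ,
    and_true, true_and, Prod.mk.injEq, Prod.exists, not_or, not_exists, not_and] at hn
  obtain ⟨⟨hn1, hn2⟩, hn3⟩ := hn
  refine ⟨fun i => if i = 0 ∨ i = 3 then r else if i = 2 then d else a, by simpa using hr,
    by simp, by simp, fun i hi => ?_⟩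
  interval_cases i
  · exact fun h => hn1 r d hr rfl (by simpa using h) rfl
  · exact fun h => hn2 r a hr rfl rfl (by simpa using h)
  · exact fun h => hn3 a d (by simpa using h) rfl rfl

/-- The guess of each vertex depends only on the colors of its neighbors. -/
def IsStrategy {V : Type*} {q : ℕ} (H : SimpleGraph V) (s : V → (V → Fin q) → Fin q) : Prop :=
  ∀ (v : V) (c c' : V → Fin q), (∀ u, H.Adj v u → c u = c' u) → s v c = s v c'

/-- Every strategy with `q` colors is defeated, even if the color of one vertex has to be one of
two prescribed colors. -/
def Flexible {V : Type*} (H : SimpleGraph V) (q : ℕ) : Prop :=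
  ∀ s : V → (V → Fin q) → Fin q, IsStrategy H s → ∀ (r : V) (x x' : Fin q), x ≠ x' →
    ∃ c : V → Fin q, (c r = x ∨ c r = x') ∧ ∀ v, s v c ≠ c v

/-- If the vertices of `K` lie in different components of `H'`, then a strategy on
`K ⊔ H'` is not better than some strategy on `K`. -/
theorem Flexible.exists_strategy {V : Type*} [Nonempty V] {q : ℕ} (hq : 2 ≤ q)
    {H H' K : SimpleGraph V} (hF : Flexible H' q) (hH : ∀ u v, H.Adj u v → K.Adj u v ∨ H'.Adj u v)
    {S : Set V} (hK : ∀ u v, K.Adj u v → u ∈ S)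
    (hsep : ∀ u ∈ S, ∀ v ∈ S, H'.Reachable u v → u = v)
    {s : V → (V → Fin q) → Fin q} (hs : IsStrategy H s) :
    ∃ e : V → (V → Fin q) → Fin q, IsStrategy K e ∧ ∀ k : V → Fin q, (∀ u ∈ S, e u k ≠ k u) →
      ∃ c : V → Fin q, (∀ u ∈ S, c u = k u) ∧ ∀ v, s v c ≠ c v := by
  classical
  let d : Fin q := ⟨0, by lia⟩
  let σ : V → (V → Fin q) → V → (V → Fin q) → Fin q := fun u k v c =>
    s v fun z => if K.Adj v z then (if K.Adj u z then k z else d) else c z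
  have hσ : ∀ u k, IsStrategy H' (σ u k) := by
    intro u k v c c' hc
    refine hs v _ _ fun z hz => ?_
    by_cases hv : K.Adj v z
    · simp [hv]
    · simpa [hv] using hc z ((hH v z hz).resolve_left hv)
  have hex : ∀ (τ : V → (V → Fin q) → Fin q) (u : V), ∃ y₀, IsStrategy H' τ → ∀ y, y₀ ≠ y →
      ∃ c : V → Fin q, c u = y ∧ ∀ v, τ v c ≠ c v := by
    intro τ u
    by_contra! hc
    obtain ⟨hτ, y, -, hy⟩ := hc d
    obtain ⟨-, y', hne, hy'⟩ := hc y
    obtain ⟨c, hcu, hcv⟩ := hF τ hτ u y y' hne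
    rcases hcu with h | h
    · obtain ⟨v, hv⟩ := hy c h
      exact hcv v hv
    · obtain ⟨v, hv⟩ := hy' c h
      exact hcv v hv
  choose E hE using hex
  refine ⟨fun u k => E (σ u k) u, fun u k k' hk => ?_, fun k hk => ?_⟩
  · have : σ u k = σ u k' := by
      funext v c
      simp only [σ]
      congr 1
      funext z
      by_cases hu : K.Adj u z
      · simp [hk z hu]
      · simp [hu]
    simp only [this]
  have hC : ∀ u, ∃ c : V → Fin q, u ∈ S → c u = k u ∧ ∀ v, σ u k v c ≠ c v := by
    intro u
    by_cases hu : u ∈ S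
    · obtain ⟨c, hc⟩ := hE (σ u k) u (hσ u k) (k u) (hk u hu)
      exact ⟨c, fun _ => hc⟩
    · exact ⟨fun _ => d, fun h => absurd h hu⟩
  choose C hC using hC
  obtain ⟨c₀, -, hc₀⟩ := hF (σ (Classical.arbitrary V) k) (hσ _ k) (Classical.arbitrary V)
    ⟨0, by lia⟩ ⟨1, by lia⟩ (by simp)
  let c : V → Fin q := fun z => if h : ∃ u ∈ S, H'.Reachable u z then C h.choose z else c₀ z
  have hcu : ∀ u ∈ S, ∀ z, H'.Reachable u z → c z = C u z := by
    intro u hu z huz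
    have h : ∃ u ∈ S, H'.Reachable u z := ⟨u, hu, huz⟩
    have : h.choose = u :=
      hsep _ h.choose_spec.1 u hu (h.choose_spec.2.trans huz.symm)
    simp only [c, dif_pos h, this]
  have hcS : ∀ u ∈ S, c u = k u := fun u hu => by
    rw [hcu u hu u (SimpleGraph.Reachable.refl u), (hC u hu).1]
  refine ⟨c, hcS, fun v => ?_⟩
  by_cases h : ∃ u ∈ S, H'.Reachable u v
  · obtain ⟨u, hu, huv⟩ := h
    rw [hcu u hu v huv]
    have := (hC u hu).2 v
    convert this using 1
    refine hs v _ _ fun z hz => ?_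
    by_cases hv : K.Adj v z
    · obtain rfl := hsep u hu v (hK v z hv) huv
      simp only [hv, if_true]
      exact hcS z (hK z u hv.symm)
    · simp only [hv, if_false]
      exact hcu u hu z (huv.trans ((hH v z hz).resolve_left hv).reachable)
  · have hv : c v = c₀ v := dif_neg h
    rw [hv]
    convert hc₀ v using 1
    refine hs v _ _ fun z hz => ?_
    have hvK : ¬ K.Adj v z := fun hvz => h ⟨v, hK v z hvz, SimpleGraph.Reachable.refl v⟩
    have hvz := (hH v z hz).resolve_left hvK
    simp only [hvK, if_false]
    exact dif_neg fun ⟨u, hu, huz⟩ => h ⟨u, hu, huz.trans hvz.symm.reachable⟩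

theorem exists_coloring_edge {V : Type*} {q : ℕ} (hq : 3 ≤ q) {r w : V} (hrw : r ≠ w)
    {e : V → (V → Fin q) → Fin q} (he : IsStrategy (SimpleGraph.edge r w) e) {x x' : Fin q}
    (hx : x ≠ x') :
    ∃ k : V → Fin q, (k r = x ∨ k r = x') ∧ ∀ u ∈ ({r, w} : Set V), e u k ≠ k u := by
  classical
  obtain ⟨y, hy⟩ : ∃ y, y ∉ ({e w fun _ => x, e w fun _ => x'} : Finset (Fin q)) := by
    by_contra! hc
    have h1 := Finset.card_le_card (fun y _ => hc y : Finset.univ ⊆ _)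
    have h2 := Finset.card_le_two (a := e w fun _ => x) (b := e w fun _ => x')
    simp only [Finset.card_univ, Fintype.card_fin] at h1
    lia
  simp only [Finset.mem_insert, Finset.mem_singleton, not_or] at hy
  have key : ∀ X : Fin q, y ≠ e w (fun _ => X) → (e r fun _ => y) ≠ X →
      ∀ u ∈ ({r, w} : Set V), e u (fun u => if u = w then y else X) ≠ if u = w then y else X := by
    rintro X h1 h2 u (rfl | rfl)
    · rw [if_neg hrw]
      convert h2 using 1
      refine he _ _ _ fun z hz => ?_
      have : z = w := by
        simp only [SimpleGraph.edge_adj] at hz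
        grind
      simp [this]
    · rw [if_pos rfl]
      convert h1.symm using 1
      refine he _ _ _ fun z hz => ?_
      exact if_neg hz.ne'
  by_cases h : (e r fun _ => y) = x
  · exact ⟨_, Or.inr (if_neg hrw), key x' hy.2 (by rwa [h])⟩
  · exact ⟨_, Or.inl (if_neg hrw), key x hy.1 h⟩

theorem exists_coloring_cycle {V : Type*} {q : ℕ} {H : SimpleGraph V} {r : V} {p : H.Walk r r}
    (hp : p.IsCycle) {X : Finset (Fin q)} (hX : CycleLosing p.length q X)
    {e : V → (V → Fin q) → Fin q}
    (he : IsStrategy (SimpleGraph.fromEdgeSet {e | e ∈ p.edges}) e) :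
    ∃ k : V → Fin q, k r ∈ X ∧ ∀ u ∈ p.support, e u k ≠ k u := by
  classical
  have hn := hp.three_le_length
  let w : ℕ → V := fun i => if i ≤ p.length then p.getVert i else p.getVert 1
  have hw : ∀ i ≤ p.length, w i = p.getVert i := fun i hi => if_pos hi
  have hw0 : w 0 = r := by simp [w]
  have hwn : w p.length = r := by simp [w]
  have hwn1 : w (p.length + 1) = w 1 := by
    rw [hw 1 (by lia)]
    exact if_neg (by lia)
  have hinj : ∀ i j, i < p.length → j < p.length → w (i + 1) = w (j + 1) → i = j := by
    intro i j hi hj hij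
    rw [hw _ (by lia), hw _ (by lia)] at hij
    have := hp.getVert_injOn (by simp; lia) (by simp; lia) hij
    lia
  have hsupp : ∀ u ∈ p.support, ∃ i < p.length, w (i + 1) = u := by
    intro u hu
    obtain ⟨i, rfl, hi⟩ := SimpleGraph.Walk.mem_support_iff_exists_getVert.1 hu
    rcases i with _ | i
    · exact ⟨p.length - 1, by lia, by
        rw [Nat.sub_add_cancel (by lia), hwn, p.getVert_zero]⟩
    · exact ⟨i, by lia, hw _ hi⟩
  have hnbr : ∀ i < p.length, ∀ z,
      (SimpleGraph.fromEdgeSet {e | e ∈ p.edges}).Adj (w (i + 1)) z → z = w i ∨ z = w (i + 2) := by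
    intro i hi z hz
    rw [SimpleGraph.fromEdgeSet_adj] at hz
    obtain ⟨j, hjl, hj⟩ := p.mk_mem_edges_iff_exists.1 hz.1
    rw [← hw j (by lia), ← hw (j + 1) (by lia), Sym2.eq_iff] at hj
    rcases hj with ⟨h1, h2⟩ | ⟨h1, h2⟩
    · right
      rcases j with _ | j
      · have : i = p.length - 1 := hinj _ _ hi (by lia) (by
          rw [Nat.sub_add_cancel (by lia), hwn, ← h1, hw0])
        rw [← h2, show i + 2 = p.length + 1 by lia, hwn1]
      · obtain rfl := hinj _ _ (by lia) hi h1
        exact h2.symm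
    · left
      obtain rfl := hinj _ _ hjl hi h2
      exact h1.symm
  obtain ⟨k, hk0, hkn, hkn1, hk⟩ := hX fun i a b =>
    e (w i) fun z => if z = w (i - 1) then a else b
  let κ : V → Fin q := fun u => if h : ∃ i < p.length, w (i + 1) = u then k (h.choose + 1) else k 0
  have hκ : ∀ i < p.length, κ (w (i + 1)) = k (i + 1) := by
    intro i hi
    have h : ∃ j < p.length, w (j + 1) = w (i + 1) := ⟨i, hi, rfl⟩
    have : h.choose = i := hinj _ _ h.choose_spec.1 hi h.choose_spec.2
    simp only [κ, dif_pos h, this]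
  have hκr : κ r = k 0 := by
    have := hκ (p.length - 1) (by lia)
    rwa [Nat.sub_add_cancel (by lia), hwn, hkn] at this
  have hκ' : ∀ i < p.length, κ (w i) = k i := by
    intro i hi
    rcases i with _ | i
    · rw [hw0, hκr]
    · exact hκ i (by lia)
  refine ⟨κ, by rwa [hκr], fun u hu => ?_⟩
  obtain ⟨i, hi, rfl⟩ := hsupp u hu
  rw [hκ i hi]
  convert hk i hi using 1
  refine he _ _ _ fun z hz => ?_
  simp only [Nat.add_sub_cancel]
  by_cases h : z = w i
  · rw [if_pos h, h, hκ' i hi]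
  · rw [if_neg h, (hnbr i hi z hz).resolve_left h]
    rcases Nat.lt_or_ge (i + 1) p.length with h' | h'
    · exact hκ (i + 1) h'
    · obtain rfl : i = p.length - 1 := by lia
      rw [show p.length - 1 + 2 = p.length + 1 by lia, hwn1, hkn1]
      exact hκ 0 (by lia)

/-- Any two cycles with different edge sets share at most one vertex. -/
def IsCactusForest {V : Type*} (G : SimpleGraph V) : Prop :=
  ∀ (v w : V) (c₁ : G.Walk v v) (c₂ : G.Walk w w), c₁.IsCycle → c₂.IsCycle →
    {e | e ∈ c₁.edges} ≠ {e | e ∈ c₂.edges} →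
    ({x | x ∈ c₁.support} ∩ {x | x ∈ c₂.support} : Set V).Subsingleton

theorem IsCactusForest.mono {V : Type*} {G G' : SimpleGraph V} (h : IsCactusForest G)
    (hle : G' ≤ G) : IsCactusForest G' := by
  intro v w c₁ c₂ h₁ h₂ hne
  have := h v w (c₁.mapLe hle) (c₂.mapLe hle) (h₁.mapLe hle) (h₂.mapLe hle)
  simpa only [SimpleGraph.Walk.edges_mapLe_eq_edges,
    SimpleGraph.Walk.support_mapLe_eq_support] using this (by simpa using hne)

/-- In a cactus forest, deleting the edges of a cycle separates its vertices. -/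
theorem IsCactusForest.eq_of_reachable {V : Type*} {G : SimpleGraph V} (h : IsCactusForest G)
    {r : V} {p : G.Walk r r} (hp : p.IsCycle) {u v : V} (hu : u ∈ p.support) (hv : v ∈ p.support)
    (huv : (G.deleteEdges {e | e ∈ p.edges}).Reachable u v) : u = v := by
  classical
  by_contra hne
  let c := p.rotate u hu
  have hc : c.IsCycle := hp.rotate hu
  have hce : ∀ e, e ∈ c.edges ↔ e ∈ p.edges := fun e => (p.rotate_edges u hu).mem_iff
  have hvc : v ∈ c.support := (p.mem_support_rotate_iff u hu).2 hv
  obtain ⟨a, b, hab⟩ : ∃ (a : G.Walk u v) (b : G.Walk v u), a.append b = c :=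
    ⟨_, _, c.take_spec hvc⟩
  have hnodup := hc.edges_nodup
  rw [← hab, SimpleGraph.Walk.edges_append] at hnodup
  have hcab : ∀ e, e ∈ c.edges ↔ e ∈ a.edges ∨ e ∈ b.edges := by
    intro e
    rw [← hab, SimpleGraph.Walk.edges_append, List.mem_append]
  cases a with
  | nil => exact hne rfl
  | @cons _ z _ huz a =>
    cases b with
    | nil => exact hne rfl
    | @cons _ y _ hvy b =>
      simp only [SimpleGraph.Walk.edges_cons] at hnodup hcab
      have hle : G.deleteEdges {e | e ∈ p.edges} ≤
          (G.deleteEdges {s(v, y)}).deleteEdges {s(u, z)} := by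
        intro i j hij
        simp only [SimpleGraph.deleteEdges_adj, Set.mem_singleton_iff] at hij ⊢
        refine ⟨⟨hij.1, fun hh => hij.2 ?_⟩, fun hh => hij.2 ?_⟩
        · exact hh ▸ (hce _).1 ((hcab _).2 (by simp))
        · exact hh ▸ (hce _).1 ((hcab _).2 (by simp))
      have hza : ((G.deleteEdges {s(v, y)}).deleteEdges {s(u, z)}).Reachable z v := by
        rw [SimpleGraph.deleteEdges_deleteEdges]
        refine ⟨a.toDeleteEdges _ fun e he he' => ?_⟩
        simp only [Set.mem_union, Set.mem_singleton_iff] at he'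
        rcases he' with rfl | rfl
        · simp only [List.cons_append, List.nodup_cons, List.nodup_append] at hnodup
          exact hnodup.2.2.2 _ he _ (by simp) rfl
        · simp only [List.cons_append, List.nodup_cons, List.mem_append, not_or] at hnodup
          exact hnodup.1.1 he
      have hne' : s(u, z) ≠ s(v, y) := by
        simp only [List.cons_append, List.nodup_cons, List.mem_append, List.mem_cons,
          not_or] at hnodup
        exact hnodup.1.2.1
      obtain ⟨x, c', hc', hx⟩ :=
        (SimpleGraph.adj_and_reachable_delete_edges_iff_exists_cycle
          (G := G.deleteEdges {s(v, y)})).1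
          ⟨by simpa [huz] using hne', (huv.mono hle).trans hza.symm⟩
      have hle' := G.deleteEdges_le {s(v, y)}
      have hsub := h _ _ p (c'.mapLe hle') hp (hc'.mapLe hle') (by
        intro heq
        have h1 : s(v, y) ∈ p.edges := (hce _).1 ((hcab _).2 (by simp))
        have h2 : s(v, y) ∈ {e | e ∈ (c'.mapLe hle').edges} := by
          rw [← heq]
          exact h1
        rw [SimpleGraph.Walk.edges_mapLe_eq_edges] at h2
        have := c'.edges_subset_edgeSet h2
        simp at this)
      have huz' : s(u, z) ∈ p.edges := (hce _).1 ((hcab _).2 (by simp))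
      rw [SimpleGraph.Walk.support_mapLe_eq_support] at hsub
      exact huz.ne (hsub
        ⟨p.fst_mem_support_of_mem_edges huz', c'.fst_mem_support_of_mem_edges hx⟩
        ⟨p.snd_mem_support_of_mem_edges huz', c'.snd_mem_support_of_mem_edges hx⟩)

theorem deleteEdges_adj_or {V : Type*} {G : SimpleGraph V} (E : Set (Sym2 V)) (u v : V)
    (h : G.Adj u v) : (SimpleGraph.fromEdgeSet E).Adj u v ∨ (G.deleteEdges E).Adj u v := by
  by_cases he : s(u, v) ∈ E
  · exact Or.inl ((SimpleGraph.fromEdgeSet_adj E).2 ⟨he, h.ne⟩)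
  · exact Or.inr (SimpleGraph.deleteEdges_adj.2 ⟨h, he⟩)

theorem IsCactusForest.flexible {V : Type*} [Finite V] [Nonempty V] {q : ℕ} (hq : 4 ≤ q)
    (G : SimpleGraph V) :
    IsCactusForest G → (q = 4 → ∀ (v : V) (c : G.Walk v v), c.IsCycle → c.length ≠ 3) →
      Flexible G q := by
  classical
  induction G using WellFoundedLT.induction with
  | ind G ih =>
  intro hG h3 s hs
  have hdel : ∀ E : Set (Sym2 V), (∃ u v, G.Adj u v ∧ s(u, v) ∈ E) →
      Flexible (G.deleteEdges E) q := by
    rintro E ⟨u, v, huv, hE⟩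
    have hle := G.deleteEdges_le E
    refine ih _ (lt_of_le_of_ne hle fun h => ?_) (hG.mono hle) fun hq v c hc => ?_
    · rw [← h, SimpleGraph.deleteEdges_adj] at huv
      exact huv.2 hE
    · simpa using h3 hq v (c.mapLe hle) (hc.mapLe hle)
  have main : ∀ (r w : V), G.Adj r w → ∀ x x' : Fin q, x ≠ x' →
      ∃ c : V → Fin q, (c r = x ∨ c r = x') ∧ ∀ v, s v c ≠ c v := by
    intro r w hrw x x' hx
    by_cases hb : G.IsBridge s(r, w)
    · have hF := hdel {s(r, w)} ⟨r, w, hrw, rfl⟩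
      obtain ⟨e, he, hek⟩ := hF.exists_strategy (by lia) (deleteEdges_adj_or _)
        (S := {r, w}) (fun u v huv => by
          simp only [SimpleGraph.fromEdgeSet_adj, Set.mem_singleton_iff, Sym2.eq_iff] at huv
          grind)
        (by
          rw [SimpleGraph.isBridge_iff] at hb
          rintro u (rfl | rfl) v (rfl | rfl) huv
          · rfl
          · exact absurd huv hb
          · exact absurd huv.symm hb
          · rfl) hs
      obtain ⟨k, hkr, hk⟩ := exists_coloring_edge (by lia) hrw.ne he hx
      obtain ⟨c, hc, hcs⟩ := hek k hk
      exact ⟨c, by rwa [hc r (by simp)], hcs⟩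
    · rw [SimpleGraph.isBridge_iff_forall_cycle_notMem hrw] at hb
      push Not at hb
      obtain ⟨z, p₀, hp₀, hrp⟩ := hb
      have hr := p₀.fst_mem_support_of_mem_edges hrp
      obtain ⟨p, hp, hrp⟩ : ∃ p : G.Walk r r, p.IsCycle ∧ s(r, w) ∈ p.edges :=
        ⟨p₀.rotate r hr, hp₀.rotate hr, (p₀.rotate_edges r hr).mem_iff.2 hrp⟩
      have hF := hdel {e | e ∈ p.edges} ⟨r, w, hrw, hrp⟩
      obtain ⟨e, he, hek⟩ := hF.exists_strategy (by lia) (deleteEdges_adj_or _)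
        (S := {u | u ∈ p.support}) (fun u v huv =>
          p.fst_mem_support_of_mem_edges ((SimpleGraph.fromEdgeSet_adj _).1 huv).1)
        (fun u hu v hv huv => hG.eq_of_reachable hp hu hv huv) hs
      have hlen := hp.three_le_length
      have hX : CycleLosing p.length q {x, x'} := by
        rcases hlen.eq_or_lt with h | h
        · rw [← h]
          refine cycleLosing_three ?_
          have : 5 ≤ q := by
            rcases hq.eq_or_lt with h4 | h4
            · exact absurd h.symm (h3 h4.symm r p hp)
            · exact h4
          rw [Finset.card_pair hx]
          nlinarith
        · exact cycleLosing_pair hq h hx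
      obtain ⟨k, hkr, hk⟩ := exists_coloring_cycle hp hX he
      obtain ⟨c, hc, hcs⟩ := hek k hk
      refine ⟨c, ?_, hcs⟩
      rw [hc r p.start_mem_support]
      simpa using hkr
  have hlose : ∃ c : V → Fin q, ∀ v, s v c ≠ c v := by
    by_cases h : ∃ r w, G.Adj r w
    · obtain ⟨r, w, hrw⟩ := h
      obtain ⟨c, -, hc⟩ := main r w hrw ⟨0, by lia⟩ ⟨1, by lia⟩ (by simp)
      exact ⟨c, hc⟩
    · push Not at h
      have : Nontrivial (Fin q) := Fin.nontrivial_iff_two_le.2 (by lia)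
      choose f hf using fun y : Fin q => exists_ne y
      refine ⟨fun v => f (s v fun _ => ⟨0, by lia⟩), fun v => ?_⟩
      convert (hf (s v fun _ => ⟨0, by lia⟩)).symm using 1
      exact hs _ _ _ fun u hu => absurd hu (h v u)
  intro r x x' hx
  by_cases h : ∃ w, G.Adj r w
  · obtain ⟨w, hrw⟩ := h
    exact main r w hrw x x' hx
  · push Not at h
    obtain ⟨c, hc⟩ := hlose
    have key : ∀ y, s r c ≠ y → ∀ v, s v (Function.update c r y) ≠ Function.update c r y v := by
      intro y hy v
      have hsv : s v (Function.update c r y) = s v c := by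
        refine hs _ _ _ fun u hu => Function.update_of_ne ?_ _ _
        rintro rfl
        exact h v hu.symm
      rw [hsv]
      by_cases hv : v = r
      · subst hv
        simpa using hy
      · simpa [Function.update_of_ne hv] using hc v
    by_cases hy : s r c = x
    · exact ⟨_, Or.inr (Function.update_self _ _ _), key x' (by rwa [hy])⟩
    · exact ⟨_, Or.inl (Function.update_self _ _ _), key x hy⟩

/-- The upper bit of a color. -/
def highBit (x : Fin 4) : Bool := decide (2 ≤ x)

/-- The lower bit of a color. -/
def lowBit (x : Fin 4) : Bool := decide (x = 1 ∨ x = 3)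

/-- The color with given bits. -/
def ofBits (b b' : Bool) : Fin 4 :=
  (if b then 2 else 0) + if b' then 1 else 0

theorem ofBits_highBit_lowBit (x : Fin 4) : ofBits (highBit x) (lowBit x) = x := by
  revert x
  decide

/-- The vertices of `S` other than `v` have a strategy with four colors such that, whenever all of
them are wrong, `v` can infer the bit `β` of its own color. -/
def Announces {V : Type*} (G : SimpleGraph V) (S : Set V) (v : V) (β : Fin 4 → Bool) : Prop :=
  ∃ (s : V → (V → Fin 4) → Fin 4) (f : (V → Fin 4) → Bool), IsStrategy G s ∧
    (∀ c c' : V → Fin 4, (∀ u, G.Adj v u → c u = c' u) → f c = f c') ∧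
    ∀ c : V → Fin 4, (∀ u ∈ S, u ≠ v → s u c ≠ c u) → β (c v) = f c

theorem announces_triangle {V : Type*} {G : SimpleGraph V} {v a b : V} (hva : G.Adj v a)
    (hab : G.Adj a b) (hbv : G.Adj b v) {S : Set V} (ha : a ∈ S) (hb : b ∈ S)
    (β : Fin 4 → Bool) : Announces G S v β := by
  classical
  refine ⟨fun u c => if u = a then -c b - (if β (c v) then 2 else 0)
    else if u = b then 1 - c a - (if β (c v) then 2 else 0) else 0,
    fun c => decide (c a + c b = 0 ∨ c a + c b = 1), ?_, ?_, fun c hc => ?_⟩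
  · intro u c c' h
    by_cases hua : u = a
    · subst hua
      simp [h b hab, h v hva.symm]
    · by_cases hub : u = b
      · subst hub
        simp [hua, h a hab.symm, h v hbv]
      · simp [hua, hub]
  · intro c c' h
    simp only [h a hva, h b hbv.symm]
  · have h1 := hc a ha hva.ne'
    have h2 := hc b hb hbv.ne
    simp only [if_true, if_neg hab.ne'] at h1 h2
    change β (c v) = decide (c a + c b = 0 ∨ c a + c b = 1)
    clear hc
    generalize β (c v) = t at h1 h2 ⊢
    generalize c a = x at h1 h2 ⊢
    generalize c b = y at h1 h2 ⊢
    revert x y t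
    decide

theorem Announces.extend {V : Type*} {G : SimpleGraph V} {S : Set V} {v w : V}
    (h : Announces G S v highBit) (hv : v ∈ S) (hw : w ∉ S) (hvw : G.Adj v w) :
    Announces G (insert w S) w highBit := by
  classical
  obtain ⟨s, f, hs, hf, hsf⟩ := h
  refine ⟨fun u c => if u = v then ofBits (f c) (highBit (c w)) else s u c,
    fun c => !lowBit (c v), ?_, ?_, fun c hc => ?_⟩
  · intro u c c' h
    by_cases huv : u = v
    · subst huv
      simp [hf c c' h, h w hvw]
    · simpa [huv] using hs u c c' h
  · intro c c' h
    simp only [h v hvw.symm]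
  · have h1 := hsf c fun u hu huv => by
      simpa [huv] using hc u (Or.inr hu) fun h => hw (h ▸ hu)
    have h2 := hc v (Or.inr hv) hvw.ne
    simp only [if_true, ← h1] at h2
    change highBit (c w) = !lowBit (c v)
    rw [Bool.eq_not]
    intro h3
    rw [h3, ofBits_highBit_lowBit] at h2
    exact h2 rfl

theorem Announces.winning {V : Type*} {G : SimpleGraph V} {S T : Set V} {v : V}
    (hS : Announces G S v highBit) (hT : Announces G T v lowBit)
    (hST : ∀ u ∈ T, u ≠ v → u ∉ S) : HatGame.Winning G fun _ => 4 := by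
  classical
  obtain ⟨s, f, hs, hf, hsf⟩ := hS
  obtain ⟨t, g, ht, hg, htg⟩ := hT
  refine ⟨fun u c => if u = v then ofBits (f c) (g c) else if u ∈ S then s u c else t u c,
    fun u c c' h => ?_, fun c => ?_⟩
  · by_cases huv : u = v
    · subst huv
      simp [hf c c' h, hg c c' h]
    · by_cases hu : u ∈ S
      · simpa [huv, hu] using hs u c c' h
      · simpa [huv, hu] using ht u c c' h
  · by_contra! hc
    have h1 := hsf c fun u hu huv => by simpa [huv, hu] using hc u
    have h2 := htg c fun u hu huv => by simpa [huv, hST u hu huv] using hc u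
    have h3 := hc v
    rw [if_pos rfl, ← h1, ← h2, ofBits_highBit_lowBit] at h3
    exact h3 rfl

theorem announces_of_length_eq_three {V : Type*} {G : SimpleGraph V} {r v : V} {p : G.Walk r r}
    (h3 : p.length = 3) (hv : v ∈ p.support) (β : Fin 4 → Bool) :
    Announces G {u | u ∈ p.support} v β := by
  classical
  have hl : (p.rotate v hv).length = 3 := by rw [p.length_rotate, h3]
  have hs : ∀ u, u ∈ (p.rotate v hv).support ↔ u ∈ p.support := fun u =>
    p.mem_support_rotate_iff v hv
  simp only [← hs]
  clear hs
  generalize p.rotate v hv = c at *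
  have h0 := c.adj_getVert_succ (i := 0) (by lia)
  have h1 := c.adj_getVert_succ (i := 1) (by lia)
  have h2 := c.adj_getVert_succ (i := 2) (by lia)
  rw [c.getVert_zero] at h0
  rw [show 2 + 1 = c.length by lia, c.getVert_length] at h2
  exact announces_triangle h0 h1 h2 (c.getVert_mem_support _) (c.getVert_mem_support _) β

theorem winning_of_hasTwoTriangles {V : Type*} {G : SimpleGraph V} (hG : G.IsCactus)
    (h : G.HasTwoTriangles) : HatGame.Winning G fun _ => 4 := by
  obtain ⟨r₁, r₂, c₁, c₂, hc₁, hc₂, h₁, h₂, hne⟩ := h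
  obtain ⟨hconn, hcac⟩ := hG
  have hsub := hcac r₁ r₂ c₁ c₂ hc₁ hc₂ hne
  obtain ⟨⟨u, v⟩, ⟨hu, hv⟩, hmin⟩ := exists_minimalFor_of_wellFoundedLT
    (fun x : V × V => x.1 ∈ c₁.support ∧ x.2 ∈ c₂.support) (fun x => G.dist x.1 x.2)
    ⟨(r₁, r₂), c₁.start_mem_support, c₂.start_mem_support⟩
  have hmin' : ∀ x ∈ c₁.support, ∀ y ∈ c₂.support, G.dist u v ≤ G.dist x y := by
    intro x hx y hy
    rcases le_total (G.dist u v) (G.dist x y) with h | h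
    · exact h
    · exact hmin (j := (x, y)) ⟨hx, hy⟩ h
  simp only at hu hv
  obtain ⟨p, hp, hpl⟩ := hconn.exists_path_of_dist u v
  have key : ∀ i ≤ p.length, Announces G
      ({x | x ∈ c₁.support} ∪ {x | ∃ j ≤ i, p.getVert j = x}) (p.getVert i) highBit := by
    intro i
    induction i with
    | zero =>
      intro _
      rw [p.getVert_zero]
      convert announces_of_length_eq_three h₁ hu highBit using 1
      ext x
      simp only [Set.mem_union, Set.mem_ofPred_eq, Nat.le_zero, exists_eq_left, p.getVert_zero]
      constructor
      · rintro (h | rfl)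
        exacts [h, hu]
      · exact Or.inl
    | succ i ih =>
      intro hi
      convert (ih (by lia)).extend (w := p.getVert (i + 1)) (Or.inr ⟨i, le_rfl, rfl⟩) ?_
        (p.adj_getVert_succ (by lia)) using 1
      · ext x
        simp only [Set.mem_union, Set.mem_ofPred_eq, Set.mem_insert_iff]
        constructor
        · rintro (h | ⟨j, hj, rfl⟩)
          · exact Or.inr (Or.inl h)
          · rcases hj.eq_or_lt with rfl | hj
            · exact Or.inl rfl
            · exact Or.inr (Or.inr ⟨j, by lia, rfl⟩)
        · rintro (rfl | h | ⟨j, hj, rfl⟩)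
          · exact Or.inr ⟨_, le_rfl, rfl⟩
          · exact Or.inl h
          · exact Or.inr ⟨j, by lia, rfl⟩
      · rintro (h | ⟨j, hj, hji⟩)
        · have h1 := hmin' _ h v hv
          have h2 := SimpleGraph.dist_le (p.drop (i + 1))
          rw [p.drop_length] at h2
          lia
        · have := hp.getVert_injOn (by simp; lia) (by simp; lia) hji
          lia
  have hS := key p.length le_rfl
  rw [p.getVert_length] at hS
  refine hS.winning (announces_of_length_eq_three h₂ hv lowBit) fun z hz hzv => ?_
  rintro (hz₁ | ⟨j, hj, rfl⟩)
  · have h0 := hmin' z hz₁ z hz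
    rw [SimpleGraph.dist_self, Nat.le_zero, (hconn u v).dist_eq_zero_iff] at h0
    subst h0
    exact hzv (hsub ⟨hz₁, hz⟩ ⟨hu, hv⟩)
  · have h1 := hmin' u hu _ hz
    have h2 := SimpleGraph.dist_le (p.take j)
    rw [p.take_length] at h2
    obtain rfl : j = p.length := by lia
    exact hzv p.getVert_length

theorem not_winning_of_forall_isStrategy {V : Type*} {G : SimpleGraph V} {q : ℕ}
    (h : ∀ s : V → (V → Fin q) → Fin q, IsStrategy G s → ∃ c : V → Fin q, ∀ v, s v c ≠ c v) :
    ¬ HatGame.Winning G fun _ => q := by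
  rintro ⟨s, hs, hw⟩
  obtain ⟨c, hc⟩ := h s hs
  obtain ⟨v, hv⟩ := hw c
  exact hc v hv

theorem Flexible.not_winning {V : Type*} [Nonempty V] {G : SimpleGraph V} {q : ℕ} (hq : 2 ≤ q)
    (h : Flexible G q) : ¬ HatGame.Winning G fun _ => q :=
  not_winning_of_forall_isStrategy fun s hs =>
    (h s hs (Classical.arbitrary V) ⟨0, by lia⟩ ⟨1, by lia⟩ (by simp)).imp fun _ hc => hc.2

theorem not_winning_four {V : Type*} [Finite V] [Nonempty V] {G : SimpleGraph V}
    (hG : IsCactusForest G) (h : ¬ G.HasTwoTriangles) : ¬ HatGame.Winning G fun _ => 4 := by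
  by_cases h3 : ∃ (v : V) (c : G.Walk v v), c.IsCycle ∧ c.length = 3
  · obtain ⟨r, p, hp, hp3⟩ := h3
    have hle := G.deleteEdges_le {e | e ∈ p.edges}
    have hF := IsCactusForest.flexible le_rfl _ (hG.mono hle) fun _ v c hc hc3 => by
      refine h ⟨_, _, c.mapLe hle, p, hc.mapLe hle, hp, by simpa using hc3, hp3, fun heq => ?_⟩
      rw [SimpleGraph.Walk.edges_mapLe_eq_edges] at heq
      obtain ⟨e, he⟩ := List.exists_mem_of_length_pos (l := c.edges) (by simp [hc3])
      have he' : e ∈ {e | e ∈ p.edges} := heq ▸ he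
      have := c.edges_subset_edgeSet he
      rw [SimpleGraph.edgeSet_deleteEdges] at this
      exact this.2 he'
    refine not_winning_of_forall_isStrategy fun s hs => ?_
    obtain ⟨e, he, hek⟩ := hF.exists_strategy (by lia) (deleteEdges_adj_or _)
      (S := {u | u ∈ p.support}) (fun u v huv =>
        p.fst_mem_support_of_mem_edges ((SimpleGraph.fromEdgeSet_adj _).1 huv).1)
      (fun u hu v hv huv => hG.eq_of_reachable hp hu hv huv) hs
    have hX : CycleLosing p.length 4 Finset.univ := by
      rw [hp3]
      exact cycleLosing_three (by simp)
    obtain ⟨k, -, hk⟩ := exists_coloring_cycle hp hX he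
    obtain ⟨c, -, hc⟩ := hek k hk
    exact ⟨c, hc⟩
  · push Not at h3
    exact (IsCactusForest.flexible le_rfl G hG fun _ => h3).not_winning (by lia)

/-- For a cactus graph `G`, the hat guessing number equals 4 iff `G` contains at
least two triangles. -/
theorem cactus_hgNumber_eq_four_iff {V : Type*} [Fintype V] (G : SimpleGraph V)
    (hG : G.IsCactus) :
    HatGame.number G = 4 ↔ G.HasTwoTriangles := by
  have : Nonempty V := hG.1.nonempty
  have hbound : ∀ q ∈ {q : ℕ | HatGame.Winning G (fun _ => q)}, q ≤ 4 := by
    intro q hq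
    by_contra! h
    exact (IsCactusForest.flexible (by lia) G hG.2 fun h4 => by lia).not_winning (by lia) hq
  constructor
  · intro h
    by_contra h2
    have hne : {q : ℕ | HatGame.Winning G (fun _ => q)}.Nonempty := by
      by_contra he
      rw [Set.not_nonempty_iff_eq_empty] at he
      rw [HatGame.number, he, csSup_empty] at h
      exact absurd h (by decide)
    have hmem := Nat.sSup_mem hne ⟨4, hbound⟩
    rw [HatGame.number] at h
    rw [h] at hmem
    exact not_winning_four hG.2 h2 hmem
  · intro h
    exact le_antisymm (csSup_le' hbound)
      (le_csSup ⟨4, hbound⟩ (winning_of_hasTwoTriangles hG h))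
end
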